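/- arXiv:2203.01836 — 4 statements merged into one kernel-verified Lean document; each statement's English description precedes it below -/
import Mathlib

section
/- Let n ≥ 2, let Ω^i be a bounded open subset of ℝ^n, let S = ∂Ω^i be its topological boundary, and assume σ_S is a finite measure. Let θ : ℝ^n → ℝ be continuous, let x ∈ ℝ^n ∖ {0}, and let k ∈ ℕ. Then the map ε ↦ ∫ G_n(x − ε·s)·θ(s) dσ_S(s) is smooth on the interval {ε : |ε|·sup_{s∈S}‖s‖ < ‖x‖} and its k-th derivative at ε = 0 equals (−1)^k · Σ_{β ∈ ℕ^n, |β| = k} (k!/β!)·(D^β G_n)(x) · ∫ s^β·θ(s) dσ_S(s). -/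
open MeasureTheory RealInnerProductSpace Pointwise

/-- The measure `σ_S`: the `(n-1)`-dimensional Hausdorff measure on `ℝⁿ` restricted to `S`. -/
noncomputable def bdryMeasure (n : ℕ) (S : Set (EuclideanSpace ℝ (Fin n))) :
    Measure (EuclideanSpace ℝ (Fin n)) := (μH[(n : ℝ) - 1]).restrict S

/-- `s_n`: the `(n-1)`-dimensional Hausdorff measure of the unit sphere of `ℝⁿ`. -/
noncomputable def sphereArea (n : ℕ) : ℝ :=
  (μH[(n : ℝ) - 1] (Metric.sphere (0 : EuclideanSpace ℝ (Fin n)) 1)).toReal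

/-- The fundamental solution `G_n` of `-Δ` in `ℝⁿ`. -/
noncomputable def fundSol (n : ℕ) (x : EuclideanSpace ℝ (Fin n)) : ℝ :=
  if n = 2 then -(1 / (2 * Real.pi)) * Real.log ‖x‖
  else (1 / (((n : ℝ) - 2) * sphereArea n)) * ‖x‖ ^ ((2 : ℝ) - (n : ℝ))

/-- The partial derivative in the `i`-th coordinate direction. -/
noncomputable def pderiv' {n : ℕ} (i : Fin n) (F : EuclideanSpace ℝ (Fin n) → ℝ) :
    EuclideanSpace ℝ (Fin n) → ℝ :=
  fun x => lineDeriv ℝ F x (EuclideanSpace.single i 1)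

/-- The iterated partial derivative `D^β F` of multi-index `β`. -/
noncomputable def multiDeriv {n : ℕ} (β : Fin n → ℕ) (F : EuclideanSpace ℝ (Fin n) → ℝ) :
    EuclideanSpace ℝ (Fin n) → ℝ :=
  (List.finRange n).foldr (fun i G => (pderiv' i)^[β i] G) F

/-- Functions smooth off the origin, vanishing at the origin. -/
noncomputable def smoothOff (n : ℕ) : Submodule ℝ (EuclideanSpace ℝ (Fin n) → ℝ) where
  carrier := {f | ContDiffOn ℝ (⊤ : ℕ∞) f {0}ᶜ ∧ f 0 = 0}
  add_mem' := by
    rintro a b ⟨ha, ha'⟩ ⟨hb, hb'⟩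
    exact ⟨ha.add hb, by simp [ha', hb']⟩
  zero_mem' := ⟨contDiffOn_const, rfl⟩
  smul_mem' := by
    rintro c a ⟨ha, ha'⟩
    exact ⟨ha.const_smul c, by simp [ha']⟩

lemma smoothOff_contDiffAt {n : ℕ} (f : smoothOff n) {y : EuclideanSpace ℝ (Fin n)} (hy : y ≠ 0) :
    ContDiffAt ℝ (⊤ : ℕ∞) f.1 y :=
  f.2.1.contDiffAt (isOpen_compl_singleton.mem_nhds hy)

lemma smoothOff_diff {n : ℕ} (f : smoothOff n) {y : EuclideanSpace ℝ (Fin n)} (hy : y ≠ 0) :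
    DifferentiableAt ℝ f.1 y :=
  (smoothOff_contDiffAt f hy).differentiableAt (by simp)

/-- Directional derivative as an endomorphism. -/
noncomputable def dirOp {n : ℕ} (v : EuclideanSpace ℝ (Fin n)) : Module.End ℝ (smoothOff n) where
  toFun f := ⟨Set.indicator {0}ᶜ (fun y => fderiv ℝ f.1 y v), by
    refine ⟨?_, by simp⟩
    refine ContDiffOn.congr (f := fun y => fderiv ℝ f.1 y v) ?_
      (fun y hy => Set.indicator_of_mem hy _)
    exact ((contDiffOn_infty_iff_fderiv_of_isOpen isOpen_compl_singleton).1 f.2.1).2.clm_apply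
      contDiffOn_const⟩
  map_add' f g := by
    ext y
    by_cases hy : y = 0
    · simp [hy]
    · simp only [Submodule.coe_add, Pi.add_apply]
      rw [Set.indicator_of_mem hy, Set.indicator_of_mem hy, Set.indicator_of_mem hy,
        fderiv_add (smoothOff_diff f hy) (smoothOff_diff g hy)]
      rfl
  map_smul' c f := by
    ext y
    by_cases hy : y = 0
    · simp [hy]
    · simp only [Submodule.coe_smul, Pi.smul_apply, RingHom.id_apply]
      rw [Set.indicator_of_mem hy, Set.indicator_of_mem hy,
        fderiv_const_smul (smoothOff_diff f hy)]
      rfl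

lemma dirOp_apply {n : ℕ} (v : EuclideanSpace ℝ (Fin n)) (f : smoothOff n)
    {y : EuclideanSpace ℝ (Fin n)} (hy : y ≠ 0) :
    (dirOp v f).1 y = fderiv ℝ f.1 y v :=
  Set.indicator_of_mem (s := {0}ᶜ) hy (fun y => fderiv ℝ f.1 y v)

lemma smoothOff_ext {n : ℕ} {f g : smoothOff n} (h : ∀ y, y ≠ 0 → f.1 y = g.1 y) : f = g := by
  ext y
  by_cases hy : y = 0
  · rw [hy, f.2.2, g.2.2]
  · exact h y hy

lemma dirOp_sum {n : ℕ} (s : EuclideanSpace ℝ (Fin n)) :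
    dirOp s = ∑ i, s i • dirOp (EuclideanSpace.single i (1 : ℝ)) := by
  ext1 f
  apply smoothOff_ext
  intro y hy
  rw [dirOp_apply _ _ hy]
  have hs : s = ∑ i, s i • EuclideanSpace.single i (1 : ℝ) := by
    ext j
    simp [Pi.single_apply]
  conv_lhs => rw [hs]
  rw [map_sum, LinearMap.sum_apply]
  simp only [Submodule.coe_sum, Finset.sum_apply, map_smul, LinearMap.smul_apply,
    Submodule.coe_smul, Pi.smul_apply]
  exact Finset.sum_congr rfl fun i _ => by rw [dirOp_apply _ _ hy]

lemma dirOp_dirOp {n : ℕ} (v w : EuclideanSpace ℝ (Fin n)) (f : smoothOff n)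
    {y : EuclideanSpace ℝ (Fin n)} (hy : y ≠ 0) :
    (dirOp v (dirOp w f)).1 y = fderiv ℝ (fderiv ℝ f.1) y v w := by
  rw [dirOp_apply _ _ hy]
  have h1 : (dirOp w f).1 =ᶠ[nhds y] fun z => fderiv ℝ f.1 z w := by
    filter_upwards [isOpen_compl_singleton.mem_nhds hy] with z hz using dirOp_apply _ _ hz
  rw [h1.fderiv_eq]
  have h2 : DifferentiableAt ℝ (fderiv ℝ f.1) y :=
    ((((contDiffOn_infty_iff_fderiv_of_isOpen isOpen_compl_singleton).1 f.2.1).2).contDiffAt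
      (isOpen_compl_singleton.mem_nhds hy)).differentiableAt (by simp)
  rw [fderiv_clm_apply h2 (differentiableAt_const w)]
  simp

lemma dirOp_commute {n : ℕ} (v w : EuclideanSpace ℝ (Fin n)) : Commute (dirOp v) (dirOp w) := by
  ext1 f
  apply smoothOff_ext
  intro y hy
  change (dirOp v (dirOp w f)).1 y = (dirOp w (dirOp v f)).1 y
  rw [dirOp_dirOp _ _ _ hy, dirOp_dirOp _ _ _ hy]
  exact (smoothOff_contDiffAt f hy).isSymmSndFDerivAt
    (by rw [minSmoothness_of_isRCLikeNormedField]; exact WithTop.coe_le_coe.2 le_top) v w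

/-- The iterated partial derivative as an operator. -/
noncomputable def multiOp {n : ℕ} (β : Fin n → ℕ) : Module.End ℝ (smoothOff n) :=
  ((List.finRange n).map fun i => dirOp (EuclideanSpace.single i (1 : ℝ)) ^ β i).prod

lemma list_smul_prod {n : ℕ} {A : Type*} [Ring A] [Algebra ℝ A] (l : List (Fin n))
    (c : Fin n → ℝ) (T : Fin n → A) :
    (l.map fun i => c i • T i).prod = (l.map c).prod • (l.map T).prod := by
  induction l with
  | nil => simp
  | cons a l ih => 
    simp only [List.map_cons, List.prod_cons, ih]
    rw [smul_mul_assoc, mul_smul_comm, smul_smul]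

lemma dirOp_pow {n : ℕ} (s : EuclideanSpace ℝ (Fin n)) (k : ℕ) :
    dirOp s ^ k = ∑ β ∈ Finset.Nat.antidiagonalTuple n k,
      (((k.factorial : ℝ) / ∏ i, ((β i).factorial : ℝ)) * ∏ i, s i ^ β i) • multiOp β := by
  rw [dirOp_sum, Finset.sum_pow_eq_sum_piAntidiag_of_commute Finset.univ
    (fun i => s i • dirOp (EuclideanSpace.single i (1 : ℝ)))
    (fun i _ j _ _ => ((dirOp_commute _ _).smul_left _).smul_right _)]
  have hset : Finset.piAntidiag (Finset.univ : Finset (Fin n)) k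
      = Finset.Nat.antidiagonalTuple n k := by
    ext β; simp [Finset.Nat.mem_antidiagonalTuple]
  rw [hset]
  refine Finset.sum_congr rfl fun β hβ => ?_
  rw [Finset.Nat.mem_antidiagonalTuple] at hβ
  have h1 : Finset.noncommProd (Finset.univ : Finset (Fin n))
      (fun i => (s i • dirOp (EuclideanSpace.single i (1 : ℝ))) ^ β i)
      (fun i _ j _ _ => (((dirOp_commute _ _).smul_left _).smul_right _).pow_pow _ _)
      = (∏ i, s i ^ β i) • multiOp β := by
    have : Finset.noncommProd (Finset.univ : Finset (Fin n))
      (fun i => (s i • dirOp (EuclideanSpace.single i (1 : ℝ))) ^ β i)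
      (fun i _ j _ _ => (((dirOp_commute _ _).smul_left _).smul_right _).pow_pow _ _)
      = ((List.finRange n).map fun i =>
        (s i • dirOp (EuclideanSpace.single i (1 : ℝ))) ^ β i).prod :=
      Multiset.noncommProd_coe _ _
    rw [this]
    simp_rw [smul_pow]
    rw [list_smul_prod (List.finRange n) (fun i => s i ^ β i)
      (fun i => dirOp (EuclideanSpace.single i (1 : ℝ)) ^ β i)]
    rw [← List.ofFn_eq_map, List.prod_ofFn]
    rfl
  rw [h1]
  have h2 : (Nat.multinomial Finset.univ β : ℝ)
      = (k.factorial : ℝ) / ∏ i, ((β i).factorial : ℝ) := by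
    rw [eq_div_iff (by positivity)]
    have := Nat.multinomial_spec (Finset.univ : Finset (Fin n)) β
    rw [hβ] at this
    rw [mul_comm]
    exact_mod_cast this
  rw [← h2, mul_smul, Nat.cast_smul_eq_nsmul, nsmul_eq_mul]

lemma pderiv_eqOn {n : ℕ} (i : Fin n) (F : EuclideanSpace ℝ (Fin n) → ℝ) (f : smoothOff n)
    (h : ∀ y, y ≠ 0 → F y = f.1 y) :
    ∀ y, y ≠ 0 → pderiv' i F y = (dirOp (EuclideanSpace.single i (1 : ℝ)) f).1 y := by
  intro y hy
  have h1 : F =ᶠ[nhds y] f.1 := by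
    filter_upwards [isOpen_compl_singleton.mem_nhds hy] with z hz using h z hz
  rw [dirOp_apply _ _ hy, pderiv', ← (smoothOff_diff f hy).lineDeriv_eq_fderiv, h1.lineDeriv_eq]

lemma pderiv_iter_eqOn {n : ℕ} (i : Fin n) (m : ℕ) (F : EuclideanSpace ℝ (Fin n) → ℝ)
    (f : smoothOff n) (h : ∀ y, y ≠ 0 → F y = f.1 y) :
    ∀ y, y ≠ 0 → (pderiv' i)^[m] F y
      = ((dirOp (EuclideanSpace.single i (1 : ℝ)) ^ m) f).1 y := by
  induction m with
  | zero => simpa using h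
  | succ m ih =>
    rw [Function.iterate_succ_apply', pow_succ']
    exact pderiv_eqOn i _ _ ih

lemma multiDeriv_eqOn {n : ℕ} (β : Fin n → ℕ) (F : EuclideanSpace ℝ (Fin n) → ℝ)
    (f : smoothOff n) (h : ∀ y, y ≠ 0 → F y = f.1 y) :
    ∀ y, y ≠ 0 → multiDeriv β F y = (multiOp β f).1 y := by
  unfold multiDeriv multiOp
  induction List.finRange n with
  | nil => simpa using h
  | cons a l ih =>
    simp only [List.foldr_cons, List.map_cons, List.prod_cons]
    exact pderiv_iter_eqOn a _ _ _ ih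

lemma fundSol_contDiffOn (n : ℕ) : ContDiffOn ℝ (⊤ : ℕ∞) (fundSol n) {0}ᶜ := by
  intro y hy
  apply ContDiffAt.contDiffWithinAt
  have hy' : ‖y‖ ≠ 0 := norm_ne_zero_iff.2 hy
  have hnorm : ContDiffAt ℝ (⊤ : ℕ∞) (fun z : EuclideanSpace ℝ (Fin n) => ‖z‖) y :=
    contDiffAt_norm ℝ hy
  unfold fundSol
  split_ifs with h
  · exact contDiffAt_const.mul (hnorm.log hy')
  · exact contDiffAt_const.mul (hnorm.rpow_const_of_ne hy')

/-- The fundamental solution as an element of `smoothOff`. -/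
noncomputable def fundOff (n : ℕ) : smoothOff n :=
  ⟨Set.indicator {0}ᶜ (fundSol n),
    (fundSol_contDiffOn n).congr (fun _ hy => Set.indicator_of_mem hy _), by simp⟩

lemma fundOff_eq {n : ℕ} (y : EuclideanSpace ℝ (Fin n)) (hy : y ≠ 0) :
    fundSol n y = (fundOff n).1 y := (Set.indicator_of_mem (s := {0}ᶜ) hy _).symm

lemma hasDerivAt_line {n : ℕ} (f : smoothOff n) (x s : EuclideanSpace ℝ (Fin n)) (ε : ℝ)
    (h : x - ε • s ≠ 0) :
    HasDerivAt (fun ε : ℝ => f.1 (x - ε • s)) (-(dirOp s f).1 (x - ε • s)) ε := by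
  have h1 : HasDerivAt (fun ε : ℝ => x - ε • s) (-s) ε := by
    simpa using ((hasDerivAt_id ε).smul_const s).const_sub x
  have h2 := (smoothOff_diff f h).hasFDerivAt.comp_hasDerivAt ε h1
  rw [dirOp_apply _ _ h, ← map_neg]
  exact h2

lemma smooth_of_chain (H : ℕ → ℝ → ℝ) (I : Set ℝ) (hI : IsOpen I)
    (h : ∀ j, ∀ ε ∈ I, HasDerivAt (H j) (H (j + 1) ε) ε) :
    ContDiffOn ℝ (⊤ : ℕ∞) (H 0) I ∧ ∀ k, ∀ ε ∈ I, iteratedDeriv k (H 0) ε = H k ε := by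
  constructor
  · rw [contDiffOn_infty]
    intro m
    have : ∀ j, ContDiffOn ℝ (m : ℕ) (H j) I := by
      induction m with
      | zero =>
        intro j
        exact contDiffOn_zero.2 fun ε hε => (h j ε hε).continuousAt.continuousWithinAt
      | succ m ih =>
        intro j
        push_cast
        rw [contDiffOn_succ_iff_deriv_of_isOpen hI]
        refine ⟨fun ε hε => (h j ε hε).differentiableAt.differentiableWithinAt, by simp, ?_⟩
        exact (ih (j + 1)).congr fun ε hε => (h j ε hε).deriv
    exact this 0
  · intro k
    induction k with
    | zero => simp
    | succ k ih =>
      intro ε hε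
      rw [iteratedDeriv_succ]
      have : iteratedDeriv k (H 0) =ᶠ[nhds ε] H k := by
        filter_upwards [hI.mem_nhds hε] with z hz using ih z hz
      rw [this.deriv_eq, (h k ε hε).deriv]

lemma hasDerivAt_param {E : Type*} [NormedAddCommGroup E] [MeasurableSpace E] [BorelSpace E]
    (K : Set E) (hK : IsCompact K) (ν : Measure E)
    [IsFiniteMeasure (ν.restrict K)] (I : Set ℝ) (hI : IsOpen I) (φ ψ : ℝ → E → ℝ)
    (hφ : ContinuousOn (fun p : ℝ × E => φ p.1 p.2) (I ×ˢ K))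
    (hψ : ContinuousOn (fun p : ℝ × E => ψ p.1 p.2) (I ×ˢ K))
    (h : ∀ ε ∈ I, ∀ s ∈ K, HasDerivAt (fun ε => φ ε s) (ψ ε s) ε) (ε : ℝ) (hε : ε ∈ I) :
    HasDerivAt (fun ε => ∫ s in K, φ ε s ∂ν) (∫ s in K, ψ ε s ∂ν) ε := by
  have hKm : MeasurableSet K := hK.isClosed.measurableSet
  obtain ⟨δ, hδ, hball⟩ := Metric.isOpen_iff.1 hI ε hε
  have hsub : Metric.closedBall ε (δ / 2) ⊆ I :=
    (Metric.closedBall_subset_ball (by linarith)).trans hball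
  have hsl : ∀ χ : ℝ → E → ℝ, ContinuousOn (fun p : ℝ × E => χ p.1 p.2) (I ×ˢ K) →
      ∀ t ∈ I, ContinuousOn (χ t) K := fun χ hχ t ht =>
    hχ.comp (f := fun s => (t, s)) (by fun_prop) (fun s hs => ⟨ht, hs⟩)
  have hmeas : ∀ χ : ℝ → E → ℝ, ContinuousOn (fun p : ℝ × E => χ p.1 p.2) (I ×ˢ K) →
      ∀ t ∈ I, AEStronglyMeasurable (χ t) (ν.restrict K) := fun χ hχ t ht =>
    (hsl χ hχ t ht).aestronglyMeasurable_of_isCompact hK hKm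
  obtain ⟨C, hC⟩ := ((isCompact_closedBall ε (δ / 2)).prod hK).exists_bound_of_continuousOn
    (hψ.mono (Set.prod_mono hsub le_rfl))
  refine (hasDerivAt_integral_of_dominated_loc_of_deriv_le
    (Metric.closedBall_mem_nhds ε (half_pos hδ)) (bound := fun _ => C) ?_ ?_ ?_ ?_ ?_ ?_).2
  · filter_upwards [hI.mem_nhds hε] with t ht using hmeas φ hφ t ht
  · obtain ⟨B, hB⟩ := hK.exists_bound_of_continuousOn (hsl φ hφ ε hε)
    exact Integrable.of_bound (hmeas φ hφ ε hε) B
      ((ae_restrict_mem hKm).mono fun s hs => hB s hs)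
  · exact hmeas ψ hψ ε hε
  · exact (ae_restrict_mem hKm).mono fun s hs t ht => hC (t, s) ⟨ht, hs⟩
  · exact integrable_const C
  · exact (ae_restrict_mem hKm).mono fun s hs t ht => h t (hsub ht) s hs

/-- The map `ε ↦ ∫_{∂Ωⁱ} G_n(x - ε•s) θ(s) dσ(s)` is smooth on
`{ε : |ε| · sup_{s ∈ ∂Ωⁱ} ‖s‖ < ‖x‖}` and its `k`-th derivative at `ε = 0` is
`(-1)^k ∑_{|β|=k} (k!/β!) (D^β G_n)(x) ∫_{∂Ωⁱ} s^β θ(s) dσ(s)`. -/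
theorem stmt5 (n : ℕ) (hn : 2 ≤ n) (Ωi : Set (EuclideanSpace ℝ (Fin n)))
    (hΩ : IsOpen Ωi) (hb : Bornology.IsBounded Ωi)
    (hfin : IsFiniteMeasure (bdryMeasure n (frontier Ωi)))
    (θ : EuclideanSpace ℝ (Fin n) → ℝ) (hθ : Continuous θ)
    (x : EuclideanSpace ℝ (Fin n)) (hx : x ≠ 0) (k : ℕ) :
    ContDiffOn ℝ (⊤ : ℕ∞) (fun ε : ℝ => ∫ s, fundSol n (x - ε • s) * θ s ∂(bdryMeasure n (frontier Ωi)))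
        {ε : ℝ | |ε| * sSup ((fun s => ‖s‖) '' frontier Ωi) < ‖x‖} ∧
    iteratedDeriv k
        (fun ε : ℝ => ∫ s, fundSol n (x - ε • s) * θ s ∂(bdryMeasure n (frontier Ωi))) 0 =
      (-1 : ℝ) ^ k * ∑ β ∈ Finset.Nat.antidiagonalTuple n k,
        ((k.factorial : ℝ) / ∏ i, ((β i).factorial : ℝ)) * multiDeriv β (fundSol n) x *
          ∫ s, (∏ i, s i ^ β i) * θ s ∂(bdryMeasure n (frontier Ωi)) := by
  have hK : IsCompact (frontier Ωi) :=
    Metric.isCompact_of_isClosed_isBounded isClosed_frontier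
      (hb.closure.subset frontier_subset_closure)
  set K := frontier Ωi with hKdef
  unfold bdryMeasure at hfin ⊢
  set ν : Measure (EuclideanSpace ℝ (Fin n)) := μH[(n : ℝ) - 1] with hν
  have hKm : MeasurableSet K := hK.isClosed.measurableSet
  set I : Set ℝ := {ε : ℝ | |ε| * sSup ((fun s => ‖s‖) '' K) < ‖x‖} with hIdef
  have hI : IsOpen I := isOpen_lt (by fun_prop) continuous_const
  have h0 : (0 : ℝ) ∈ I := by simpa [hIdef] using hx
  have hne : ∀ ε ∈ I, ∀ s ∈ K, x - ε • s ≠ 0 := by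
    intro ε hε s hs h
    have h1 : ‖s‖ ≤ sSup ((fun s => ‖s‖) '' K) :=
      le_csSup (hK.image continuous_norm).bddAbove ⟨s, hs, rfl⟩
    have h2 : ‖x‖ = |ε| * ‖s‖ := by rw [sub_eq_zero.1 h, norm_smul, Real.norm_eq_abs]
    have h3 : |ε| * sSup ((fun s => ‖s‖) '' K) < ‖x‖ := hε
    have := mul_le_mul_of_nonneg_left h1 (abs_nonneg ε)
    linarith
  let φ : ℕ → ℝ → EuclideanSpace ℝ (Fin n) → ℝ := fun j ε s =>
    (-1 : ℝ) ^ j * ((dirOp s ^ j) (fundOff n)).1 (x - ε • s) * θ s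
  have hφe : ∀ j ε s, φ j ε s = (-1 : ℝ) ^ j * (∑ β ∈ Finset.Nat.antidiagonalTuple n j,
      (((j.factorial : ℝ) / ∏ i, ((β i).factorial : ℝ)) * ∏ i, s i ^ β i) *
        (multiOp β (fundOff n)).1 (x - ε • s)) * θ s := by
    intro j ε s
    simp only [φ]
    rw [dirOp_pow]
    simp [LinearMap.sum_apply, Finset.sum_apply]
  have hφc : ∀ j, ContinuousOn
      (fun p : ℝ × EuclideanSpace ℝ (Fin n) => φ j p.1 p.2) (I ×ˢ K) := by
    intro j
    simp only [hφe]
    refine (continuousOn_const.mul (continuousOn_finsetSum _ fun β _ => ?_)).mul (by fun_prop)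
    refine ContinuousOn.mul (by fun_prop) ?_
    exact (multiOp β (fundOff n)).2.1.continuousOn.comp
      (f := fun p : ℝ × EuclideanSpace ℝ (Fin n) => x - p.1 • p.2) (by fun_prop)
      (fun p hp => hne _ hp.1 _ hp.2)
  have hφd : ∀ j, ∀ ε ∈ I, ∀ s ∈ K, HasDerivAt (fun ε => φ j ε s) (φ (j + 1) ε s) ε := by
    intro j ε hε s hs
    have := ((hasDerivAt_line ((dirOp s ^ j) (fundOff n)) x s ε (hne ε hε s hs)).const_mul
      ((-1 : ℝ) ^ j)).mul_const (θ s)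
    have e : φ (j + 1) ε s = (-1 : ℝ) ^ j *
        (-(dirOp s ((dirOp s ^ j) (fundOff n))).1 (x - ε • s)) * θ s := by
      simp only [φ]
      rw [pow_succ' (dirOp s), pow_succ (-1 : ℝ), Module.End.mul_apply]
      ring
    rw [e]
    exact this
  have key := smooth_of_chain (fun j ε => ∫ s in K, φ j ε s ∂ν) I hI
    (fun j ε hε => hasDerivAt_param K hK ν I hI (φ j) (φ (j + 1)) (hφc j) (hφc (j + 1)) (hφd j) ε hε)
  have hcongr : ∀ ε ∈ I, ∫ s in K, fundSol n (x - ε • s) * θ s ∂ν = ∫ s in K, φ 0 ε s ∂ν := by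
    intro ε hε
    refine setIntegral_congr_fun hKm fun s hs => ?_
    simp only [φ]
    rw [fundOff_eq _ (hne ε hε s hs)]
    simp
  refine ⟨key.1.congr hcongr, ?_⟩
  have hev : (fun ε : ℝ => ∫ s in K, fundSol n (x - ε • s) * θ s ∂ν) =ᶠ[nhds 0]
      fun ε => ∫ s in K, φ 0 ε s ∂ν := by
    filter_upwards [hI.mem_nhds h0] with ε hε using hcongr ε hε
  rw [hev.iteratedDeriv_eq k, key.2 k 0 h0]
  simp only [hφe, zero_smul, sub_zero]
  have hint : ∀ β : Fin n → ℕ, Integrable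
      (fun s : EuclideanSpace ℝ (Fin n) => (∏ i, s i ^ β i) * θ s) (ν.restrict K) := by
    intro β
    have hc : Continuous (fun s : EuclideanSpace ℝ (Fin n) => (∏ i, s i ^ β i) * θ s) := by
      fun_prop
    obtain ⟨B, hB⟩ := hK.exists_bound_of_continuousOn hc.continuousOn
    exact Integrable.of_bound hc.aestronglyMeasurable B
      ((ae_restrict_mem hKm).mono fun s hs => hB s hs)
  have hrw : ∀ s : EuclideanSpace ℝ (Fin n),
      (-1 : ℝ) ^ k * (∑ β ∈ Finset.Nat.antidiagonalTuple n k,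
      (((k.factorial : ℝ) / ∏ i, ((β i).factorial : ℝ)) * ∏ i, s i ^ β i) *
        (multiOp β (fundOff n)).1 x) * θ s
      = (-1 : ℝ) ^ k * ∑ β ∈ Finset.Nat.antidiagonalTuple n k,
        (((k.factorial : ℝ) / ∏ i, ((β i).factorial : ℝ)) * multiDeriv β (fundSol n) x) *
          ((∏ i, s i ^ β i) * θ s) := by
    intro s
    rw [mul_assoc, Finset.sum_mul]
    congr 1
    refine Finset.sum_congr rfl fun β _ => ?_
    rw [multiDeriv_eqOn β _ (fundOff n) fundOff_eq x hx]
    ring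
  simp only [hrw]
  rw [integral_const_mul, integral_finsetSum _ fun β _ => (hint β).const_mul _]
  simp only [integral_const_mul]
end

section
/- Let n ≥ 2, let Ω^i be a bounded open subset of ℝ^n, let S = ∂Ω^i be its topological boundary, and assume σ_S is a finite measure. Let ν : ℝ^n → ℝ^n and θ : ℝ^n → ℝ be continuous (in the application ν is the outward unit normal field of Ω^i, but the identity holds for any continuous vector field), let x ∈ ℝ^n ∖ {0}, and let k ∈ ℕ. Then the map ε ↦ ∫ ν(s)·∇G_n(x − ε·s)·θ(s) dσ_S(s) is smooth on {ε : |ε|·sup_{s∈S}‖s‖ < ‖x‖} and its k-th derivative at ε = 0 equals (−1)^k · Σ_{β ∈ ℕ^n, |β| = k} (k!/β!) · (∇D^β G_n)(x) · ∫ s^β·θ(s)·ν(s) dσ_S(s), where the last integral is the ℝ^n-valued Bochner integral and · denotes the Euclidean inner product. -/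
open MeasureTheory RealInnerProductSpace Pointwise

section Aux9

theorem aux_pderiv_eq {n : ℕ} {U : Set (EuclideanSpace ℝ (Fin n))} (hU : IsOpen U) {F : (EuclideanSpace ℝ (Fin n)) → ℝ}
    (hF : ContDiffOn ℝ (⊤ : ℕ∞) F U) (i : Fin n) {y : EuclideanSpace ℝ (Fin n)} (hy : y ∈ U) :
    pderiv' i F y = fderiv ℝ F y (EuclideanSpace.single i 1) := by
  have h : DifferentiableAt ℝ F y :=
    ((hF y hy).contDiffAt (hU.mem_nhds hy)).differentiableAt (by simp)
  exact h.lineDeriv_eq_fderiv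

theorem aux_pderiv_smooth {n : ℕ} {U : Set (EuclideanSpace ℝ (Fin n))} (hU : IsOpen U) {F : (EuclideanSpace ℝ (Fin n)) → ℝ}
    (hF : ContDiffOn ℝ (⊤ : ℕ∞) F U) (i : Fin n) :
    ContDiffOn ℝ (⊤ : ℕ∞) (pderiv' i F) U := by
  have h1 : ContDiffOn ℝ (⊤ : ℕ∞) (fderiv ℝ F) U := hF.fderiv_of_isOpen hU (by simp)
  have h2 : ContDiffOn ℝ (⊤ : ℕ∞) (fun y => fderiv ℝ F y (EuclideanSpace.single i 1)) U :=
    h1.clm_apply contDiffOn_const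
  exact h2.congr fun y hy => aux_pderiv_eq hU hF i hy

theorem aux_pderiv_congr {n : ℕ} {U : Set (EuclideanSpace ℝ (Fin n))} (hU : IsOpen U) {F G : (EuclideanSpace ℝ (Fin n)) → ℝ}
    (h : Set.EqOn F G U) (i : Fin n) : Set.EqOn (pderiv' i F) (pderiv' i G) U := by
  intro y hy
  have : F =ᶠ[nhds y] G := h.eventuallyEq_of_mem (hU.mem_nhds hy)
  exact this.lineDeriv_eq

theorem aux_pderiv_comm {n : ℕ} {U : Set (EuclideanSpace ℝ (Fin n))} (hU : IsOpen U) {F : (EuclideanSpace ℝ (Fin n)) → ℝ}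
    (hF : ContDiffOn ℝ (⊤ : ℕ∞) F U) (i j : Fin n) :
    Set.EqOn (pderiv' i (pderiv' j F)) (pderiv' j (pderiv' i F)) U := by
  have key : ∀ i j : Fin n, ∀ y ∈ U, pderiv' i (pderiv' j F) y =
      fderiv ℝ (fderiv ℝ F) y (EuclideanSpace.single i 1) (EuclideanSpace.single j 1) := by
    intro i j y hy
    have h1 : ContDiffOn ℝ (⊤ : ℕ∞) (fderiv ℝ F) U := hF.fderiv_of_isOpen hU (by simp)
    have h2 : ContDiffOn ℝ (⊤ : ℕ∞) (fun y => fderiv ℝ F y (EuclideanSpace.single j 1)) U :=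
      h1.clm_apply contDiffOn_const
    have hd : DifferentiableAt ℝ (fderiv ℝ F) y :=
      ((h1 y hy).contDiffAt (hU.mem_nhds hy)).differentiableAt (by simp)
    rw [aux_pderiv_congr hU (fun z hz => aux_pderiv_eq hU hF j hz) i hy,
      aux_pderiv_eq hU h2 i hy, fderiv_clm_apply hd (differentiableAt_const _)]
    simp
  intro y hy
  rw [key i j y hy, key j i y hy]
  have hs : IsSymmSndFDerivAt ℝ F y :=
    ((hF y hy).contDiffAt (hU.mem_nhds hy)).isSymmSndFDerivAt (by
      simp only [minSmoothness_of_isRCLikeNormedField]; exact WithTop.coe_le_coe.2 le_top)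
  exact hs.eq _ _

theorem aux_iter_smooth {n : ℕ} {U : Set (EuclideanSpace ℝ (Fin n))} (hU : IsOpen U) (i : Fin n) (m : ℕ) :
    ∀ {F : (EuclideanSpace ℝ (Fin n)) → ℝ}, ContDiffOn ℝ (⊤ : ℕ∞) F U →
    ContDiffOn ℝ (⊤ : ℕ∞) ((pderiv' i)^[m] F) U := by
  induction m with
  | zero => intro F hF; exact hF
  | succ m ih =>
    intro F hF
    rw [Function.iterate_succ_apply]
    exact ih (aux_pderiv_smooth hU hF i)

theorem aux_iter_congr {n : ℕ} {U : Set (EuclideanSpace ℝ (Fin n))} (hU : IsOpen U) (i : Fin n) (m : ℕ) :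
    ∀ {F G : (EuclideanSpace ℝ (Fin n)) → ℝ}, Set.EqOn F G U →
    Set.EqOn ((pderiv' i)^[m] F) ((pderiv' i)^[m] G) U := by
  induction m with
  | zero => intro F G h; exact h
  | succ m ih =>
    intro F G h
    rw [Function.iterate_succ_apply, Function.iterate_succ_apply]
    exact ih (aux_pderiv_congr hU h i)

theorem aux_iter_comm {n : ℕ} {U : Set (EuclideanSpace ℝ (Fin n))} (hU : IsOpen U) (i j : Fin n) (m : ℕ) :
    ∀ {F : (EuclideanSpace ℝ (Fin n)) → ℝ}, ContDiffOn ℝ (⊤ : ℕ∞) F U →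
    Set.EqOn ((pderiv' i)^[m] (pderiv' j F)) (pderiv' j ((pderiv' i)^[m] F)) U := by
  induction m with
  | zero => intro F hF y hy; rfl
  | succ m ih =>
    intro F hF
    rw [Function.iterate_succ_apply, Function.iterate_succ_apply]
    exact (aux_iter_congr hU i m (aux_pderiv_comm hU hF i j)).trans
      (ih (aux_pderiv_smooth hU hF i))

theorem aux_fold_smooth {n : ℕ} {U : Set (EuclideanSpace ℝ (Fin n))} (hU : IsOpen U) (β : Fin n → ℕ)
    {F : (EuclideanSpace ℝ (Fin n)) → ℝ} (hF : ContDiffOn ℝ (⊤ : ℕ∞) F U) (l : List (Fin n)) :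
    ContDiffOn ℝ (⊤ : ℕ∞) (l.foldr (fun i G => (pderiv' i)^[β i] G) F) U := by
  induction l with
  | nil => exact hF
  | cons a l ih => exact aux_iter_smooth hU a _ ih

theorem aux_fold_notMem {n : ℕ} (β : Fin n → ℕ) (i : Fin n)
    (F : (EuclideanSpace ℝ (Fin n)) → ℝ) (l : List (Fin n)) (hi : i ∉ l) :
    l.foldr (fun j G => (pderiv' j)^[(β + Pi.single i 1 : Fin n → ℕ) j] G) F =
      l.foldr (fun j G => (pderiv' j)^[β j] G) F := by
  induction l with
  | nil => rfl
  | cons a l ih =>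
    simp only [List.mem_cons, not_or] at hi
    simp only [List.foldr_cons]
    rw [ih hi.2]
    simp [Pi.single_eq_of_ne (Ne.symm hi.1)]

theorem aux_fold_succ {n : ℕ} {U : Set (EuclideanSpace ℝ (Fin n))} (hU : IsOpen U) (β : Fin n → ℕ) (i : Fin n)
    {F : (EuclideanSpace ℝ (Fin n)) → ℝ} (hF : ContDiffOn ℝ (⊤ : ℕ∞) F U) (l : List (Fin n)) (hl : l.Nodup)
    (hi : i ∈ l) :
    Set.EqOn (l.foldr (fun j G => (pderiv' j)^[(β + Pi.single i 1 : Fin n → ℕ) j] G) F)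
      (pderiv' i (l.foldr (fun j G => (pderiv' j)^[β j] G) F)) U := by
  induction l with
  | nil => simp at hi
  | cons a l ih =>
    rw [List.nodup_cons] at hl
    simp only [List.foldr_cons]
    by_cases h : i = a
    · subst h
      rw [aux_fold_notMem β i F l hl.1]
      simp only [Pi.add_apply, Pi.single_eq_same, Function.iterate_succ_apply']
      exact fun _ _ => rfl
    · have hil : i ∈ l := by simpa [h] using hi
      have e : (β + Pi.single i 1 : Fin n → ℕ) a = β a := by simp [Pi.single_eq_of_ne (Ne.symm h)]
      rw [e]
      exact (aux_iter_congr hU a _ (ih hl.2 hil)).trans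
        (aux_iter_comm hU a i _ (aux_fold_smooth hU β hF l))

theorem aux_multi_smooth {n : ℕ} {U : Set (EuclideanSpace ℝ (Fin n))} (hU : IsOpen U) (β : Fin n → ℕ)
    {F : (EuclideanSpace ℝ (Fin n)) → ℝ} (hF : ContDiffOn ℝ (⊤ : ℕ∞) F U) :
    ContDiffOn ℝ (⊤ : ℕ∞) (multiDeriv β F) U := aux_fold_smooth hU β hF _

theorem aux_multi_succ {n : ℕ} {U : Set (EuclideanSpace ℝ (Fin n))} (hU : IsOpen U) (β : Fin n → ℕ) (i : Fin n)
    {F : (EuclideanSpace ℝ (Fin n)) → ℝ} (hF : ContDiffOn ℝ (⊤ : ℕ∞) F U) :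
    Set.EqOn (multiDeriv (β + Pi.single i 1) F) (pderiv' i (multiDeriv β F)) U :=
  aux_fold_succ hU β i hF _ (List.nodup_finRange n) (List.mem_finRange i)

theorem aux_multi_zero {n : ℕ} (F : (EuclideanSpace ℝ (Fin n)) → ℝ) : multiDeriv 0 F = F := by
  unfold multiDeriv
  induction List.finRange n with
  | nil => rfl
  | cons a l ih => simp

theorem aux_fundSol_smooth (n : ℕ) :
    ContDiffOn ℝ (⊤ : ℕ∞) (fundSol n) {y : EuclideanSpace ℝ (Fin n) | y ≠ 0} := by
  intro y hy
  have hn : ContDiffAt ℝ (⊤ : ℕ∞) (fun z : EuclideanSpace ℝ (Fin n) => ‖z‖) y := contDiffAt_norm ℝ hy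
  have h0 : ‖y‖ ≠ 0 := norm_ne_zero_iff.2 hy
  apply ContDiffAt.contDiffWithinAt
  by_cases h2 : n = 2
  · have : fundSol n = fun z => -(1 / (2 * Real.pi)) * Real.log ‖z‖ := by
      funext z; simp [fundSol, h2]
    rw [this]
    exact contDiffAt_const.mul (hn.log h0)
  · have : fundSol n = fun z => (1 / (((n : ℝ) - 2) * sphereArea n)) * ‖z‖ ^ ((2 : ℝ) - (n : ℝ)) := by
      funext z; simp [fundSol, h2]
    rw [this]
    exact contDiffAt_const.mul (hn.rpow_const_of_ne h0)

theorem aux_fderiv_eq {n : ℕ} {U : Set (EuclideanSpace ℝ (Fin n))} (hU : IsOpen U) {F : (EuclideanSpace ℝ (Fin n)) → ℝ}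
    (hF : ContDiffOn ℝ (⊤ : ℕ∞) F U) {y : EuclideanSpace ℝ (Fin n)} (hy : y ∈ U) (v : EuclideanSpace ℝ (Fin n)) :
    fderiv ℝ F y v = ∑ i, v i * pderiv' i F y := by
  have hv : v = ∑ i, v i • EuclideanSpace.single i (1 : ℝ) := by
    ext j
    simp [Finset.sum_apply, Pi.single_apply]
  conv_lhs => rw [hv]
  rw [map_sum]
  refine Finset.sum_congr rfl fun i _ => ?_
  rw [map_smul, aux_pderiv_eq hU hF i hy, smul_eq_mul]

/-- Auxiliary: the linear map on polynomials sending `X^m` to `D^m F (y)`. -/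
noncomputable def auxPhi {n : ℕ} (F : EuclideanSpace ℝ (Fin n) → ℝ)
    (y : EuclideanSpace ℝ (Fin n)) : MvPolynomial (Fin n) ℝ →ₗ[ℝ] ℝ :=
  (MvPolynomial.basisMonomials (Fin n) ℝ).constr ℝ (fun m => multiDeriv (m : Fin n → ℕ) F y)

/-- Auxiliary: the linear form with coefficients `v`. -/
noncomputable def auxLin {n : ℕ} (v : EuclideanSpace ℝ (Fin n)) : MvPolynomial (Fin n) ℝ :=
  ∑ i, MvPolynomial.monomial (Finsupp.single i 1) (v i)

theorem auxPhi_monomial {n : ℕ} (F : EuclideanSpace ℝ (Fin n) → ℝ)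
    (y : EuclideanSpace ℝ (Fin n)) (m : Fin n →₀ ℕ) (c : ℝ) :
    auxPhi F y (MvPolynomial.monomial m c) = c * multiDeriv (m : Fin n → ℕ) F y := by
  have h1 : MvPolynomial.monomial m c = c • (MvPolynomial.basisMonomials (Fin n) ℝ m) := by
    simp [MvPolynomial.coe_basisMonomials, MvPolynomial.smul_monomial]
  rw [h1, map_smul, auxPhi, Module.Basis.constr_basis, smul_eq_mul]

theorem auxPhi_lin_monomial {n : ℕ} {U : Set (EuclideanSpace ℝ (Fin n))} (hU : IsOpen U)
    {F : EuclideanSpace ℝ (Fin n) → ℝ} (hF : ContDiffOn ℝ (⊤ : ℕ∞) F U)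
    {y : EuclideanSpace ℝ (Fin n)} (hy : y ∈ U) (v : EuclideanSpace ℝ (Fin n))
    (m : Fin n →₀ ℕ) (c : ℝ) :
    auxPhi F y (auxLin v * MvPolynomial.monomial m c) =
      c * fderiv ℝ (multiDeriv (m : Fin n → ℕ) F) y v := by
  rw [aux_fderiv_eq hU (aux_multi_smooth hU _ hF) hy, auxLin, Finset.sum_mul, map_sum,
    Finset.mul_sum]
  refine Finset.sum_congr rfl fun i _ => ?_
  rw [MvPolynomial.monomial_mul, auxPhi_monomial, ← aux_multi_succ hU _ i hF hy]
  have : ((Finsupp.single i 1 + m : Fin n →₀ ℕ) : Fin n → ℕ) =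
      (m : Fin n → ℕ) + Pi.single i 1 := by
    rw [Finsupp.coe_add, Finsupp.single_eq_pi_single, add_comm]
  rw [this]
  ring

theorem auxPhi_hasDerivAt {n : ℕ} {U : Set (EuclideanSpace ℝ (Fin n))} (hU : IsOpen U)
    {F : EuclideanSpace ℝ (Fin n) → ℝ} (hF : ContDiffOn ℝ (⊤ : ℕ∞) F U)
    (x s : EuclideanSpace ℝ (Fin n)) (t : ℝ) (hy : x - t • s ∈ U)
    (p : MvPolynomial (Fin n) ℝ) :
    HasDerivAt (fun t : ℝ => auxPhi F (x - t • s) p)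
      (-(auxPhi F (x - t • s) (auxLin s * p))) t := by
  induction p using MvPolynomial.induction_on' with
  | monomial m c =>
    simp only [auxPhi_monomial]
    rw [auxPhi_lin_monomial hU hF hy]
    have hd : HasFDerivAt (multiDeriv (m : Fin n → ℕ) F)
        (fderiv ℝ (multiDeriv (m : Fin n → ℕ) F) (x - t • s)) (x - t • s) :=
      (((aux_multi_smooth hU _ hF _ hy).contDiffAt (hU.mem_nhds hy)).differentiableAt
        (by simp)).hasFDerivAt
    have hl : HasDerivAt (fun t : ℝ => x - t • s) (-s) t := by
      simpa using ((hasDerivAt_id t).smul_const s).const_sub x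
    have := (hd.comp_hasDerivAt t hl).const_mul c
    simpa using this
  | add p q hp hq =>
    have := hp.add hq
    simp only [mul_add, map_add, neg_add]
    exact this

theorem auxLin_pow {n : ℕ} (s : EuclideanSpace ℝ (Fin n)) (k : ℕ) :
    auxLin s ^ k = ∑ β ∈ Finset.Nat.antidiagonalTuple n k,
      MvPolynomial.monomial (Finsupp.equivFunOnFinite.symm β)
        (((k.factorial : ℝ) / ∏ i, ((β i).factorial : ℝ)) * ∏ i, s i ^ β i) := by
  rw [auxLin, Finset.sum_pow_eq_sum_piAntidiag, Finset.piAntidiag_univ_fin_eq_antidiagonalTuple]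
  refine Finset.sum_congr rfl fun β hβ => ?_
  rw [Finset.Nat.mem_antidiagonalTuple] at hβ
  have h1 : ((Nat.multinomial Finset.univ β : ℕ) : ℝ) =
      (k.factorial : ℝ) / ∏ i, ((β i).factorial : ℝ) := by
    have := Nat.multinomial_spec Finset.univ β
    rw [hβ] at this
    have h0 : (∏ i, ((β i).factorial : ℝ)) ≠ 0 :=
      Finset.prod_ne_zero_iff.2 fun i _ => by exact_mod_cast (β i).factorial_ne_zero
    rw [eq_div_iff h0, mul_comm]
    exact_mod_cast this
  have h2 : ∏ i, (MvPolynomial.monomial (Finsupp.single i 1) (s i)) ^ β i =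
      MvPolynomial.monomial (Finsupp.equivFunOnFinite.symm β) (∏ i, s i ^ β i) := by
    simp only [MvPolynomial.monomial_pow]
    rw [← MvPolynomial.monomial_sum_prod]
    have h3 : (∑ i, β i • Finsupp.single i 1 : Fin n →₀ ℕ) = Finsupp.equivFunOnFinite.symm β := by
      ext j
      simp [Finsupp.finsetSum_apply, Finsupp.single_apply]
    rw [h3]
  rw [h2, ← h1, ← MvPolynomial.C_mul_monomial]
  simp

theorem auxPhi_expand {n : ℕ} {U : Set (EuclideanSpace ℝ (Fin n))} (hU : IsOpen U)
    {F : EuclideanSpace ℝ (Fin n) → ℝ} (hF : ContDiffOn ℝ (⊤ : ℕ∞) F U)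
    {y : EuclideanSpace ℝ (Fin n)} (hy : y ∈ U) (v s : EuclideanSpace ℝ (Fin n)) (k : ℕ) :
    auxPhi F y (auxLin v * auxLin s ^ k) = ∑ β ∈ Finset.Nat.antidiagonalTuple n k,
      ((k.factorial : ℝ) / ∏ i, ((β i).factorial : ℝ)) * (∏ i, s i ^ β i) *
        fderiv ℝ (multiDeriv β F) y v := by
  rw [auxLin_pow, Finset.mul_sum, map_sum]
  refine Finset.sum_congr rfl fun β _ => ?_
  rw [auxPhi_lin_monomial hU hF hy]
  simp

theorem aux_iterate {V : Set ℝ} (hV : IsOpen V) (I : ℕ → ℝ → ℝ)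
    (h : ∀ j, ∀ t ∈ V, HasDerivAt (I j) (I (j + 1) t) t) :
    ContDiffOn ℝ (⊤ : ℕ∞) (I 0) V ∧ ∀ k, ∀ t ∈ V, iteratedDeriv k (I 0) t = I k t := by
  have h2 : ∀ k, ∀ t ∈ V, iteratedDeriv k (I 0) t = I k t := by
    intro k
    induction k with
    | zero => intro t _; simp
    | succ k ih =>
      intro t ht
      rw [iteratedDeriv_succ]
      have : iteratedDeriv k (I 0) =ᶠ[nhds t] I k :=
        Filter.mem_of_superset (hV.mem_nhds ht) ih
      rw [this.deriv_eq, (h k t ht).deriv]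
  refine ⟨?_, h2⟩
  apply contDiffOn_of_differentiableOn_deriv
  intro m _
  have : DifferentiableOn ℝ (I m) V := fun t ht =>
    (h m t ht).differentiableAt.differentiableWithinAt
  refine this.congr fun t ht => ?_
  rw [iteratedDerivWithin_of_isOpen hV ht, h2 m t ht]

/-- differentiation under the integral, continuous version on a compact set -/
theorem aux_param {E : Type*} [NormedAddCommGroup E] [MeasurableSpace E] [BorelSpace E]
    [SecondCountableTopology E]
    (μ : Measure E) {S : Set E} (hS : IsCompact S) [IsFiniteMeasure (μ.restrict S)]
    {V : Set ℝ} (hV : IsOpen V) (f f' : ℝ → E → ℝ)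
    (hf : ∀ t ∈ V, ContinuousOn (f t) S)
    (hf' : ContinuousOn (fun q : ℝ × E => f' q.1 q.2) (V ×ˢ S))
    (hd : ∀ t ∈ V, ∀ s ∈ S, HasDerivAt (fun t => f t s) (f' t s) t) (t : ℝ) (ht : t ∈ V) :
    HasDerivAt (fun t => ∫ s, f t s ∂(μ.restrict S)) (∫ s, f' t s ∂(μ.restrict S)) t := by
  obtain ⟨r, hr, hrV⟩ := Metric.nhds_basis_closedBall.mem_iff.1 (hV.mem_nhds ht)
  have hSm : MeasurableSet S := hS.isClosed.measurableSet
  obtain ⟨C, hC⟩ := ((isCompact_closedBall t r).prod hS).exists_bound_of_continuousOn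
    (hf'.mono (Set.prod_mono hrV le_rfl))
  have hmem : ∀ᵐ s ∂(μ.restrict S), s ∈ S := ae_restrict_mem hSm
  have hms : ∀ g : E → ℝ, ContinuousOn g S → AEStronglyMeasurable g (μ.restrict S) :=
    fun g hg => hg.aestronglyMeasurable hSm
  refine (hasDerivAt_integral_of_dominated_loc_of_deriv_le (bound := fun _ => C)
    (Metric.closedBall_mem_nhds t hr) ?_ ?_ ?_ ?_ (integrable_const C) ?_).2
  · filter_upwards [hV.mem_nhds ht] with u hu using hms _ (hf u hu)
  · obtain ⟨D, hD⟩ := hS.exists_bound_of_continuousOn (hf t ht)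
    refine Integrable.of_bound (hms _ (hf t ht)) D ?_
    filter_upwards [hmem] with s hs using hD s hs
  · apply hms
    exact hf'.comp (f := fun s => (t, s)) (by fun_prop) (fun s hs => ⟨ht, hs⟩)
  · filter_upwards [hmem] with s hs u hu using hC (u, s) ⟨hu, hs⟩
  · filter_upwards [hmem] with s hs u hu using hd u (hrV hu) s hs

end Aux9

/-- The map `ε ↦ ∫_{∂Ωⁱ} ν(s) · ∇G_n(x - ε•s) θ(s) dσ(s)` is smooth on
`{ε : |ε| · sup_{s∈∂Ωⁱ} ‖s‖ < ‖x‖}` and its `k`-th derivative at `ε = 0` is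
`(-1)^k ∑_{|β|=k} (k!/β!) (∇D^β G_n)(x) · ∫_{∂Ωⁱ} s^β θ(s) ν(s) dσ(s)`. -/
theorem stmt9 (n : ℕ) (hn : 2 ≤ n) (Ωi : Set (EuclideanSpace ℝ (Fin n)))
    (hΩ : IsOpen Ωi) (hb : Bornology.IsBounded Ωi)
    (hfin : IsFiniteMeasure (bdryMeasure n (frontier Ωi)))
    (ν : EuclideanSpace ℝ (Fin n) → EuclideanSpace ℝ (Fin n)) (hν : Continuous ν)
    (θ : EuclideanSpace ℝ (Fin n) → ℝ) (hθ : Continuous θ)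
    (x : EuclideanSpace ℝ (Fin n)) (hx : x ≠ 0) (k : ℕ) :
    ContDiffOn ℝ (⊤ : ℕ∞)
        (fun ε : ℝ => ∫ s, ⟪ν s, gradient (fundSol n) (x - ε • s)⟫ * θ s
          ∂(bdryMeasure n (frontier Ωi)))
        {ε : ℝ | |ε| * sSup ((fun s => ‖s‖) '' frontier Ωi) < ‖x‖} ∧
    iteratedDeriv k
        (fun ε : ℝ => ∫ s, ⟪ν s, gradient (fundSol n) (x - ε • s)⟫ * θ s
          ∂(bdryMeasure n (frontier Ωi))) 0 =
      (-1 : ℝ) ^ k * ∑ β ∈ Finset.Nat.antidiagonalTuple n k,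
        ((k.factorial : ℝ) / ∏ i, ((β i).factorial : ℝ)) *
          ⟪gradient (multiDeriv β (fundSol n)) x,
            ∫ s, ((∏ i, s i ^ β i) * θ s) • ν s ∂(bdryMeasure n (frontier Ωi))⟫ := by
  classical
  set S := frontier Ωi with hSdef
  have hS : IsCompact S :=
    hb.isCompact_closure.of_isClosed_subset isClosed_frontier frontier_subset_closure
  have hSm : MeasurableSet S := hS.isClosed.measurableSet
  set G := fundSol n with hG
  set R := sSup ((fun s => ‖s‖) '' S) with hR
  set U : Set (EuclideanSpace ℝ (Fin n)) := {y | y ≠ 0} with hUdef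
  have hU : IsOpen U := isOpen_ne
  have hGs : ContDiffOn ℝ (⊤ : ℕ∞) G U := aux_fundSol_smooth n
  set V : Set ℝ := {ε : ℝ | |ε| * R < ‖x‖} with hVdef
  have hV : IsOpen V := isOpen_lt (by fun_prop) continuous_const
  have hV0 : (0 : ℝ) ∈ V := by simp [hVdef, hx]
  have hxU : x ∈ U := hx
  have hmemU : ∀ t ∈ V, ∀ s ∈ S, x - t • s ∈ U := by
    intro t ht s hs h0
    have hsR : ‖s‖ ≤ R :=
      le_csSup (hS.image continuous_norm).bddAbove (Set.mem_image_of_mem _ hs)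
    have hxe : x = t • s := sub_eq_zero.1 h0
    have h1 : ‖x‖ = |t| * ‖s‖ := by rw [hxe, norm_smul, Real.norm_eq_abs]
    have h2 : |t| * R < ‖x‖ := ht
    have h3 : |t| * ‖s‖ ≤ |t| * R := mul_le_mul_of_nonneg_left hsR (abs_nonneg t)
    linarith
  unfold bdryMeasure at hfin ⊢
  set μ : Measure (EuclideanSpace ℝ (Fin n)) := μH[(n : ℝ) - 1] with hμ
  have hmem : ∀ᵐ s ∂(μ.restrict S), s ∈ S := ae_restrict_mem hSm
  let J : ℕ → ℝ → EuclideanSpace ℝ (Fin n) → ℝ := fun j t s =>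
    (-1 : ℝ) ^ j * auxPhi G (x - t • s) (auxLin (ν s) * auxLin s ^ j) * θ s
  have hJc : ∀ j, ContinuousOn (fun q : ℝ × EuclideanSpace ℝ (Fin n) => J j q.1 q.2)
      (V ×ˢ S) := by
    intro j
    have hmaps : Set.MapsTo (fun q : ℝ × EuclideanSpace ℝ (Fin n) => x - q.1 • q.2)
        (V ×ˢ S) U := fun q hq => hmemU q.1 hq.1 q.2 hq.2
    have hc : ContinuousOn (fun q : ℝ × EuclideanSpace ℝ (Fin n) =>
        (-1 : ℝ) ^ j * (∑ β ∈ Finset.Nat.antidiagonalTuple n j,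
          ((j.factorial : ℝ) / ∏ i, ((β i).factorial : ℝ)) * (∏ i, q.2 i ^ β i) *
          fderiv ℝ (multiDeriv β G) (x - q.1 • q.2) (ν q.2)) * θ q.2) (V ×ˢ S) := by
      refine ContinuousOn.mul (ContinuousOn.mul continuousOn_const ?_) (by fun_prop)
      refine continuousOn_finsetSum _ fun β _ => ?_
      refine ContinuousOn.mul (by fun_prop) ?_
      have h1 : ContinuousOn (fderiv ℝ (multiDeriv β G)) U :=
        (aux_multi_smooth hU β hGs).continuousOn_fderiv_of_isOpen hU (by simp)
      have h2 : ContinuousOn (fun q : ℝ × EuclideanSpace ℝ (Fin n) =>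
          fderiv ℝ (multiDeriv β G) (x - q.1 • q.2)) (V ×ˢ S) :=
        h1.comp (by fun_prop) hmaps
      exact h2.clm_apply (by fun_prop)
    refine hc.congr fun q hq => ?_
    simp only [J]
    rw [auxPhi_expand hU hGs (hmaps hq)]
  have hJd : ∀ j, ∀ t ∈ V, ∀ s ∈ S, HasDerivAt (fun t => J j t s) (J (j + 1) t s) t := by
    intro j t ht s hs
    have h := ((auxPhi_hasDerivAt hU hGs x s t (hmemU t ht s hs)
      (auxLin (ν s) * auxLin s ^ j)).const_mul ((-1 : ℝ) ^ j)).mul_const (θ s)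
    have e : auxLin s * (auxLin (ν s) * auxLin s ^ j) = auxLin (ν s) * auxLin s ^ (j + 1) := by
      ring
    rw [e] at h
    refine h.congr_deriv ?_
    simp only [J]
    ring
  have hI := aux_iterate hV (fun j t => ∫ s, J j t s ∂(μ.restrict S)) (fun j t ht =>
    aux_param μ hS hV (J j) (J (j + 1))
      (fun t ht => (hJc j).comp (f := fun s => (t, s)) (by fun_prop) (fun s hs => ⟨ht, hs⟩))
      (hJc (j + 1)) (hJd j) t ht)
  have hEq : Set.EqOn (fun ε : ℝ => ∫ s, ⟪ν s, gradient G (x - ε • s)⟫ * θ s ∂(μ.restrict S))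
      (fun t => ∫ s, J 0 t s ∂(μ.restrict S)) V := by
    intro t ht
    refine integral_congr_ae ?_
    filter_upwards [hmem] with s hs
    have h := auxPhi_expand hU hGs (hmemU t ht s hs) (ν s) s 0
    simp only [J]
    rw [h, real_inner_comm, inner_gradient_left]
    have h0 : multiDeriv (fun _ => 0) G = G := aux_multi_zero G
    have h00 : Finset.Nat.antidiagonalTuple n 0 = {0} := Finset.Nat.antidiagonalTuple_zero_right n
    rw [h00]
    simp [aux_multi_zero]
  refine ⟨hI.1.congr hEq, ?_⟩
  rw [(hEq.eventuallyEq_of_mem (hV.mem_nhds hV0)).iteratedDeriv_eq k, hI.2 k 0 hV0]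
  have hint : ∀ β : Fin n → ℕ,
      Integrable (fun s => ((∏ i, s i ^ β i) * θ s) • ν s) (μ.restrict S) := by
    intro β
    have hc : Continuous (fun s : EuclideanSpace ℝ (Fin n) =>
        ((∏ i, s i ^ β i) * θ s) • ν s) := by fun_prop
    obtain ⟨D, hD⟩ := hS.exists_bound_of_continuousOn hc.continuousOn
    refine Integrable.of_bound hc.aestronglyMeasurable D ?_
    filter_upwards [hmem] with s hs using hD s hs
  have hpt : ∀ s, J k 0 s = (-1 : ℝ) ^ k * ∑ β ∈ Finset.Nat.antidiagonalTuple n k,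
        ((k.factorial : ℝ) / ∏ i, ((β i).factorial : ℝ)) *
          ⟪gradient (multiDeriv β G) x, ((∏ i, s i ^ β i) * θ s) • ν s⟫ := by
    intro s
    simp only [J, zero_smul, sub_zero]
    rw [auxPhi_expand hU hGs hxU, mul_assoc, Finset.sum_mul]
    congr 1
    refine Finset.sum_congr rfl fun β _ => ?_
    rw [inner_smul_right, inner_gradient_left]
    ring
  simp only [hpt]
  rw [integral_const_mul, integral_finsetSum]
  · congr 1
    refine Finset.sum_congr rfl fun β _ => ?_
    rw [integral_const_mul, integral_inner (hint β)]
  · intro β _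
    exact ((hint β).const_inner _).const_mul _
end

section
/- Let n ≥ 2, let Ω^i be a bounded open subset of ℝ^n, let S = ∂Ω^i, and assume σ_S is a finite measure. Let θ : ℝ^n → ℝ be continuous, let v ∈ ℝ^n be a fixed vector (in the application v = ν_{Ω^o}(x), the outward unit normal of an outer domain at x), let x ∈ ℝ^n ∖ {0}, and let k ∈ ℕ. Then the map ε ↦ ∫ v·∇G_n(x − ε·s)·θ(s) dσ_S(s) is smooth on {ε : |ε|·sup_{s∈S}‖s‖ < ‖x‖} and its k-th derivative at ε = 0 equals (−1)^k · Σ_{β ∈ ℕ^n, |β| = k} (k!/β!) · (v·(∇D^β G_n)(x)) · ∫ s^β·θ(s) dσ_S(s), where · denotes the Euclidean inner product. -/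
open MeasureTheory RealInnerProductSpace Pointwise

abbrev EE (n : ℕ) := EuclideanSpace ℝ (Fin n)

section aux
variable {n : ℕ}

lemma ld_eq {V : Set (EE n)} (hV : IsOpen V) {F : EE n → ℝ} (hF : ContDiffOn ℝ (⊤ : ℕ∞) F V)
    (w : EE n) : Set.EqOn (fun y => lineDeriv ℝ F y w) (fun y => fderiv ℝ F y w) V := by
  intro y hy
  have : DifferentiableAt ℝ F y := (hF.contDiffAt (hV.mem_nhds hy)).differentiableAt (by simp)
  exact this.lineDeriv_eq_fderiv

lemma ld_smooth {V : Set (EE n)} (hV : IsOpen V) {F : EE n → ℝ}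
    (hF : ContDiffOn ℝ (⊤ : ℕ∞) F V) (w : EE n) :
    ContDiffOn ℝ (⊤ : ℕ∞) (fun y => lineDeriv ℝ F y w) V := by
  refine ContDiffOn.congr ?_ (ld_eq hV hF w)
  have := hF.fderiv_of_isOpen (m := (⊤ : ℕ∞)) hV (by simp)
  exact this.clm_apply contDiffOn_const

lemma ld_congr {V : Set (EE n)} (hV : IsOpen V) {F G : EE n → ℝ} (h : Set.EqOn F G V)
    (w : EE n) : Set.EqOn (fun y => lineDeriv ℝ F y w) (fun y => lineDeriv ℝ G y w) V := by
  intro y hy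
  have : F =ᶠ[nhds y] G := h.eventuallyEq_of_mem (hV.mem_nhds hy)
  exact this.lineDeriv_eq

lemma ld_comm {V : Set (EE n)} (hV : IsOpen V) {F : EE n → ℝ}
    (hF : ContDiffOn ℝ (⊤ : ℕ∞) F V) (w z : EE n) :
    Set.EqOn (fun y => lineDeriv ℝ (fun y => lineDeriv ℝ F y z) y w)
      (fun y => lineDeriv ℝ (fun y => lineDeriv ℝ F y w) y z) V := by
  have key : ∀ w z : EE n, ∀ y ∈ V, lineDeriv ℝ (fun y => lineDeriv ℝ F y z) y w
      = fderiv ℝ (fderiv ℝ F) y w z := by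
    intro w z y hy
    have hd : DifferentiableAt ℝ (fderiv ℝ F) y :=
      ((hF.fderiv_of_isOpen (m := (⊤ : ℕ∞)) hV (by simp)).contDiffAt
        (hV.mem_nhds hy)).differentiableAt (by simp)
    refine (ld_congr hV (ld_eq hV hF z) w hy).trans ?_
    beta_reduce
    have h2 : HasFDerivAt (fun y => fderiv ℝ F y z)
        ((ContinuousLinearMap.apply ℝ ℝ z).comp (fderiv ℝ (fderiv ℝ F) y)) y :=
      (ContinuousLinearMap.apply ℝ ℝ z).hasFDerivAt.comp y hd.hasFDerivAt
    rw [h2.differentiableAt.lineDeriv_eq_fderiv, h2.fderiv]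
    rfl
  intro y hy
  simp only [key _ _ y hy]
  have hs : IsSymmSndFDerivAt ℝ F y :=
    (hF.contDiffAt (hV.mem_nhds hy)).isSymmSndFDerivAt (by simp; exact WithTop.coe_le_coe.2 le_top)
  exact hs w z

lemma iter_smooth {V : Set (EE n)} (hV : IsOpen V) (i : Fin n) (m : ℕ) {F : EE n → ℝ}
    (hF : ContDiffOn ℝ (⊤ : ℕ∞) F V) : ContDiffOn ℝ (⊤ : ℕ∞) ((pderiv' i)^[m] F) V := by
  induction m with
  | zero => simpa
  | succ m ih => rw [Function.iterate_succ_apply']; exact ld_smooth hV ih _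

lemma iter_congr {V : Set (EE n)} (hV : IsOpen V) (i : Fin n) (m : ℕ) {F G : EE n → ℝ}
    (h : Set.EqOn F G V) : Set.EqOn ((pderiv' i)^[m] F) ((pderiv' i)^[m] G) V := by
  induction m with
  | zero => simpa
  | succ m ih =>
    rw [Function.iterate_succ_apply', Function.iterate_succ_apply']; exact ld_congr hV ih _

lemma iter_comm {V : Set (EE n)} (hV : IsOpen V) (i : Fin n) (m : ℕ) {F : EE n → ℝ}
    (hF : ContDiffOn ℝ (⊤ : ℕ∞) F V) (w : EE n) :
    Set.EqOn ((pderiv' i)^[m] (fun y => lineDeriv ℝ F y w))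
      (fun y => lineDeriv ℝ ((pderiv' i)^[m] F) y w) V := by
  induction m with
  | zero => intro y hy; rfl
  | succ m ih =>
    rw [Function.iterate_succ_apply', Function.iterate_succ_apply']
    exact (ld_congr hV ih _).trans (ld_comm hV (iter_smooth hV i m hF) _ w)

noncomputable def fo (l : List (Fin n)) (β : Fin n → ℕ) (F : EE n → ℝ) : EE n → ℝ :=
  l.foldr (fun i G => (pderiv' i)^[β i] G) F

lemma fo_smooth {V : Set (EE n)} (hV : IsOpen V) (l : List (Fin n)) (β : Fin n → ℕ)
    {F : EE n → ℝ}
    (hF : ContDiffOn ℝ (⊤ : ℕ∞) F V) : ContDiffOn ℝ (⊤ : ℕ∞) (fo l β F) V := by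
  induction l with
  | nil => exact hF
  | cons i t ih => exact iter_smooth hV i _ ih

lemma fo_comm {V : Set (EE n)} (hV : IsOpen V) (l : List (Fin n)) (β : Fin n → ℕ)
    {F : EE n → ℝ} (hF : ContDiffOn ℝ (⊤ : ℕ∞) F V) (w : EE n) :
    Set.EqOn (fo l β (fun y => lineDeriv ℝ F y w)) (fun y => lineDeriv ℝ (fo l β F) y w) V := by
  induction l with
  | nil => intro y hy; rfl
  | cons i t ih =>
    exact (iter_congr hV i (β i) ih).trans (iter_comm hV i (β i) (fo_smooth hV t β hF) w)

lemma fo_not_mem (l : List (Fin n)) (β : Fin n → ℕ) (i : Fin n) (hi : i ∉ l) (F : EE n → ℝ) :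
    fo l (β + Pi.single i 1) F = fo l β F := by
  induction l with
  | nil => rfl
  | cons j t ih =>
    simp only [List.mem_cons, not_or] at hi
    have h1 : (β + Pi.single i 1 : Fin n → ℕ) j = β j := by simp [Ne.symm hi.1]
    change (pderiv' j)^[(β + Pi.single i 1 : Fin n → ℕ) j] (fo t (β + Pi.single i 1) F) = _
    rw [h1, ih hi.2]; rfl

lemma fo_succ {V : Set (EE n)} (hV : IsOpen V) (l : List (Fin n)) (hl : l.Nodup)
    (β : Fin n → ℕ) (i : Fin n) (hi : i ∈ l)
    {F : EE n → ℝ} (hF : ContDiffOn ℝ (⊤ : ℕ∞) F V) :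
    Set.EqOn (fo l (β + Pi.single i 1) F) (pderiv' i (fo l β F)) V := by
  induction l with
  | nil => simp at hi
  | cons j t ih =>
    rw [List.nodup_cons] at hl
    change Set.EqOn ((pderiv' j)^[(β + Pi.single i 1 : Fin n → ℕ) j] (fo t (β + Pi.single i 1) F))
      (pderiv' i ((pderiv' j)^[β j] (fo t β F))) V
    by_cases hij : i = j
    · subst hij
      rw [fo_not_mem t β i hl.1]
      have h1 : (β + Pi.single i 1 : Fin n → ℕ) i = β i + 1 := by simp
      rw [h1, Function.iterate_succ_apply']
      exact fun y hy => rfl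
    · have h1 : (β + Pi.single i 1 : Fin n → ℕ) j = β j := by simp [Ne.symm hij]
      rw [h1]
      have hit : i ∈ t := by
        rcases List.mem_cons.1 hi with h | h
        · exact absurd h hij
        · exact h
      exact (iter_congr hV j (β j) (ih hl.2 hit)).trans
        (iter_comm hV j (β j) (fo_smooth hV t β hF) _)

lemma md_smooth {V : Set (EE n)} (hV : IsOpen V) (β : Fin n → ℕ) {F : EE n → ℝ}
    (hF : ContDiffOn ℝ (⊤ : ℕ∞) F V) : ContDiffOn ℝ (⊤ : ℕ∞) (multiDeriv β F) V :=
  fo_smooth hV _ β hF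

lemma md_comm {V : Set (EE n)} (hV : IsOpen V) (β : Fin n → ℕ)
    {F : EE n → ℝ} (hF : ContDiffOn ℝ (⊤ : ℕ∞) F V) (w : EE n) :
    Set.EqOn (multiDeriv β (fun y => lineDeriv ℝ F y w))
      (fun y => lineDeriv ℝ (multiDeriv β F) y w) V := fo_comm hV _ β hF w

lemma md_succ {V : Set (EE n)} (hV : IsOpen V) (β : Fin n → ℕ) (i : Fin n)
    {F : EE n → ℝ} (hF : ContDiffOn ℝ (⊤ : ℕ∞) F V) :
    Set.EqOn (multiDeriv (β + Pi.single i 1) F) (pderiv' i (multiDeriv β F)) V :=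
  fo_succ hV _ (List.nodup_finRange n) β i (List.mem_finRange i) hF

lemma md_congr {V : Set (EE n)} (hV : IsOpen V) (β : Fin n → ℕ) {F G : EE n → ℝ}
    (h : Set.EqOn F G V) : Set.EqOn (multiDeriv β F) (multiDeriv β G) V := by
  change Set.EqOn (fo (List.finRange n) β F) (fo (List.finRange n) β G) V
  induction List.finRange n with
  | nil => exact h
  | cons i t ih => exact iter_congr hV i _ ih

lemma md_zero (F : EE n → ℝ) : multiDeriv 0 F = F := by
  change fo (List.finRange n) 0 F = F
  induction List.finRange n with
  | nil => rfl
  | cons i t ih => exact ih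

/-- Reindexing identity behind the multinomial formula. -/
lemma multi_sum (k : ℕ) (a : (Fin n → ℕ) → ℝ) :
    ∑ β ∈ Finset.Nat.antidiagonalTuple n k,
      ((k.factorial : ℝ) / ∏ i, ((β i).factorial : ℝ)) * ∑ i, a (β + Pi.single i 1)
    = ∑ γ ∈ Finset.Nat.antidiagonalTuple n (k + 1),
      (((k + 1).factorial : ℝ) / ∏ i, ((γ i).factorial : ℝ)) * a γ := by
  have hR : ∀ γ ∈ Finset.Nat.antidiagonalTuple n (k + 1),
      (((k + 1).factorial : ℝ) / ∏ i, ((γ i).factorial : ℝ)) * a γ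
      = ∑ i, ((γ i : ℝ) * (k.factorial : ℝ) / ∏ i, ((γ i).factorial : ℝ)) * a γ := by
    intro γ hγ
    rw [Finset.Nat.mem_antidiagonalTuple] at hγ
    rw [← Finset.sum_mul, ← Finset.sum_div, ← Finset.sum_mul, ← Nat.cast_sum, hγ,
      Nat.factorial_succ]
    push_cast; rfl
  rw [Finset.sum_congr rfl hR, Finset.sum_comm]
  simp only [Finset.mul_sum]
  rw [Finset.sum_comm]
  refine Finset.sum_congr rfl fun i _ => ?_
  have hsum : ∀ β : Fin n → ℕ, ∑ j, (β + Pi.single i 1 : Fin n → ℕ) j = ∑ j, β j + 1 := by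
    intro β
    simp [Finset.sum_add_distrib]
  refine Finset.sum_bij_ne_zero (fun β _ _ => β + Pi.single i 1) ?_ ?_ ?_ ?_
  · intro β hβ _
    rw [Finset.Nat.mem_antidiagonalTuple] at hβ ⊢
    rw [hsum, hβ]
  · intro β _ _ β' _ _ h
    exact add_right_cancel h
  · intro γ hγ hne
    have hpos : γ i ≠ 0 := by
      rintro h0
      simp [h0] at hne
    have hγe : γ - Pi.single i 1 + Pi.single i 1 = γ := by
      ext j
      by_cases hj : j = i
      · subst hj; simp; omega
      · simp [hj]
    have hmem : γ - Pi.single i 1 ∈ Finset.Nat.antidiagonalTuple n k := by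
      rw [Finset.Nat.mem_antidiagonalTuple] at hγ ⊢
      have := hsum (γ - Pi.single i 1)
      rw [hγe, hγ] at this
      omega
    refine ⟨γ - Pi.single i 1, hmem, ?_, hγe⟩
    rw [hγe]
    refine mul_ne_zero (div_ne_zero (by positivity) (Finset.prod_ne_zero_iff.2 fun j _ => by positivity)) ?_
    exact right_ne_zero_of_mul hne
  · intro β hβ _
    congr 1
    have hp : ∏ j, (((β + Pi.single i 1 : Fin n → ℕ) j).factorial : ℝ)
        = (β i + 1) * ∏ j, ((β j).factorial : ℝ) := by
      rw [← Finset.mul_prod_erase _ _ (Finset.mem_univ i),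
        ← Finset.mul_prod_erase Finset.univ (fun j => ((β j).factorial : ℝ)) (Finset.mem_univ i),
        ← mul_assoc]
      congr 1
      · simp [Nat.factorial_succ]
      · refine Finset.prod_congr rfl fun j hj => ?_
        simp [Finset.ne_of_mem_erase hj]
    rw [hp]
    have : (β i : ℝ) + 1 ≠ 0 := by positivity
    have h3 : ∏ j, ((β j).factorial : ℝ) ≠ 0 := Finset.prod_ne_zero_iff.2 fun j _ => by positivity
    simp only [Pi.add_apply, Pi.single_eq_same]
    push_cast
    field_simp

noncomputable def II (μ : Measure (EE n)) (x : EE n) (F h : EE n → ℝ) (ε : ℝ) : ℝ :=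
  ∫ s, F (x - ε • s) * h s ∂μ

lemma integrable_of_cont {μ : Measure (EE n)} [IsFiniteMeasure μ] {K : Set (EE n)}
    (hK : IsCompact K) (hμ : μ.restrict K = μ) {g : EE n → ℝ} (hg : ContinuousOn g K) :
    Integrable g μ := by
  have := hg.integrableOn_compact (μ := μ) hK
  rwa [IntegrableOn, hμ] at this

lemma ae_K {μ : Measure (EE n)} {K : Set (EE n)}
    (hK : IsCompact K) (hμ : μ.restrict K = μ) : ∀ᵐ s ∂μ, s ∈ K := by
  rw [← hμ]; exact ae_restrict_mem hK.measurableSet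

lemma II_deriv {μ : Measure (EE n)} [IsFiniteMeasure μ] {K : Set (EE n)}
    (hK : IsCompact K) (hμ : μ.restrict K = μ) {V : Set (EE n)} (hV : IsOpen V)
    {U : Set ℝ} (hU : IsOpen U) {x : EE n} (hxV : ∀ ε ∈ U, ∀ s ∈ K, x - ε • s ∈ V)
    {F h : EE n → ℝ} (hF : ContDiffOn ℝ (⊤ : ℕ∞) F V) (hh : Continuous h) {ε : ℝ} (hε : ε ∈ U) :
    HasDerivAt (II μ x F h) (-∑ i, II μ x (pderiv' i F) (fun s => s i * h s) ε) ε := by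
  have hcont : ∀ G : EE n → ℝ, ContinuousOn G V →
      ContinuousOn (fun p : ℝ × EE n => G (x - p.1 • p.2)) (U ×ˢ K) := by
    intro G hG
    refine hG.comp (by fun_prop) ?_
    rintro ⟨e, s⟩ ⟨he, hs⟩
    exact hxV e he s hs
  have hcont1 : ∀ G : EE n → ℝ, ContinuousOn G V → ∀ e ∈ U,
      ContinuousOn (fun s : EE n => G (x - e • s)) K := by
    intro G hG e he
    refine hG.comp (by fun_prop) ?_
    intro s hs
    exact hxV e he s hs
  have hpc : ∀ i, ContinuousOn (pderiv' i F) V := fun i => (ld_smooth hV hF _).continuousOn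
  obtain ⟨r, hr, hrU⟩ := Metric.isOpen_iff.1 hU ε hε
  have hsub : Metric.closedBall ε (r / 2) ⊆ U :=
    (Metric.closedBall_subset_ball (by linarith)).trans hrU
  let F' : ℝ → EE n → ℝ := fun e s => -∑ i, pderiv' i F (x - e • s) * (s i * h s)
  have hF'c : ContinuousOn (fun p : ℝ × EE n => F' p.1 p.2) (U ×ˢ K) := by
    refine ContinuousOn.neg (continuousOn_finsetSum _ fun i _ => ?_)
    refine (hcont _ (hpc i)).mul (Continuous.continuousOn ?_)
    fun_prop
  obtain ⟨C, hC⟩ := ((isCompact_closedBall ε (r / 2)).prod hK).exists_bound_of_continuousOn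
    (hF'c.mono (Set.prod_mono hsub le_rfl))
  have hae := ae_K hK hμ
  have key := hasDerivAt_integral_of_dominated_loc_of_deriv_le (μ := μ)
    (F := fun e s => F (x - e • s) * h s) (F' := F') (x₀ := ε) (bound := fun _ => C)
    (s := Metric.closedBall ε (r / 2))
    (Metric.closedBall_mem_nhds ε (by linarith)) ?_ ?_ ?_ ?_ (integrable_const C) ?_
  · have h2 := key.2
    have : ∫ s, F' ε s ∂μ = -∑ i, II μ x (pderiv' i F) (fun s => s i * h s) ε := by
      simp only [F', II]
      rw [integral_neg, integral_finsetSum]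
      intro i _
      exact integrable_of_cont hK hμ ((hcont1 _ (hpc i) ε hε).mul
        (Continuous.continuousOn (by fun_prop)))
    rw [this] at h2
    exact h2
  · filter_upwards [hU.mem_nhds hε] with e he
    exact (integrable_of_cont hK hμ ((hcont1 F hF.continuousOn e he).mul
        hh.continuousOn)).aestronglyMeasurable
  · exact (integrable_of_cont hK hμ ((hcont1 F hF.continuousOn ε hε).mul hh.continuousOn))
  · refine (integrable_of_cont hK hμ ?_).aestronglyMeasurable
    exact hF'c.comp (f := fun s => (ε, s)) (by fun_prop) (fun s hs => ⟨hε, hs⟩)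
  · filter_upwards [hae] with s hs e he
    exact hC (e, s) ⟨he, hs⟩
  · filter_upwards [hae] with s hs e he
    have hmem := hxV e (hsub he) s hs
    have hd : DifferentiableAt ℝ F (x - e • s) :=
      (hF.contDiffAt (hV.mem_nhds hmem)).differentiableAt (by simp)
    have h1 : HasDerivAt (fun e : ℝ => x - e • s) (-s) e := by
      simpa using ((hasDerivAt_id e).smul_const s).const_sub x
    have h2 := (hd.hasFDerivAt.comp_hasDerivAt e h1).mul_const (h s)
    refine h2.congr_deriv ?_
    simp only [F', map_neg]
    have hs' : s = ∑ i, s i • EuclideanSpace.single i (1 : ℝ) := by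
      ext j
      simp [Finset.sum_apply, EuclideanSpace.single, Pi.single_apply]
    have h3 : fderiv ℝ F (x - e • s) s = ∑ i, s i * pderiv' i F (x - e • s) := by
      have := congrArg (fderiv ℝ F (x - e • s)) hs'
      rw [this, map_sum]
      refine Finset.sum_congr rfl fun i _ => ?_
      rw [map_smul, smul_eq_mul]
      congr 1
      exact (ld_eq hV hF _ hmem).symm
    rw [h3, neg_mul, Finset.sum_mul]
    congr 1
    refine Finset.sum_congr rfl fun i _ => ?_
    ring

lemma II_smooth {μ : Measure (EE n)} [IsFiniteMeasure μ] {K : Set (EE n)}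
    (hK : IsCompact K) (hμ : μ.restrict K = μ) {V : Set (EE n)} (hV : IsOpen V)
    {U : Set ℝ} (hU : IsOpen U) {x : EE n} (hxV : ∀ ε ∈ U, ∀ s ∈ K, x - ε • s ∈ V) (m : ℕ) :
    ∀ {F h : EE n → ℝ} (_ : ContDiffOn ℝ (⊤ : ℕ∞) F V) (_ : Continuous h),
    ContDiffOn ℝ m (II μ x F h) U := by
  induction m with
  | zero =>
    intro F h hF hh
    simp only [Nat.cast_zero, contDiffOn_zero]
    exact fun e he => (II_deriv hK hμ hV hU hxV hF hh he).continuousAt.continuousWithinAt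
  | succ m ih =>
    intro F h hF hh
    push_cast
    rw [contDiffOn_succ_iff_deriv_of_isOpen hU]
    refine ⟨fun e he => (II_deriv hK hμ hV hU hxV hF hh he).differentiableAt.differentiableWithinAt,
      by simp, ?_⟩
    refine ContDiffOn.congr ?_ (fun e he => (II_deriv hK hμ hV hU hxV hF hh he).deriv)
    refine ContDiffOn.neg (ContDiffOn.sum fun i _ => ih (ld_smooth hV hF _) (by fun_prop))

lemma II_iter {μ : Measure (EE n)} [IsFiniteMeasure μ] {K : Set (EE n)}
    (hK : IsCompact K) (hμ : μ.restrict K = μ) {V : Set (EE n)} (hV : IsOpen V)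
    {U : Set ℝ} (hU : IsOpen U) {x : EE n} (hxV : ∀ ε ∈ U, ∀ s ∈ K, x - ε • s ∈ V)
    {F h : EE n → ℝ} (hF : ContDiffOn ℝ (⊤ : ℕ∞) F V) (hh : Continuous h) (k : ℕ) :
    ∀ ε ∈ U, iteratedDeriv k (II μ x F h) ε =
      (-1 : ℝ) ^ k * ∑ β ∈ Finset.Nat.antidiagonalTuple n k,
        ((k.factorial : ℝ) / ∏ i, ((β i).factorial : ℝ)) *
          II μ x (multiDeriv β F) (fun s => (∏ i, s i ^ β i) * h s) ε := by
  induction k with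
  | zero =>
    intro ε _
    have h0 : Finset.Nat.antidiagonalTuple n 0 = {0} := Finset.Nat.antidiagonalTuple_zero_right n
    rw [h0, Finset.sum_singleton, md_zero]
    simp
  | succ k ih =>
    intro ε hε
    rw [iteratedDeriv_succ]
    have he : iteratedDeriv k (II μ x F h) =ᶠ[nhds ε] fun ε =>
      (-1 : ℝ) ^ k * ∑ β ∈ Finset.Nat.antidiagonalTuple n k,
        ((k.factorial : ℝ) / ∏ i, ((β i).factorial : ℝ)) *
          II μ x (multiDeriv β F) (fun s => (∏ i, s i ^ β i) * h s) ε := by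
      filter_upwards [hU.mem_nhds hε] with e he using ih e he
    rw [he.deriv_eq]
    have hD := HasDerivAt.const_mul ((-1 : ℝ) ^ k) (HasDerivAt.fun_sum
      (u := Finset.Nat.antidiagonalTuple n k) (fun β _ => HasDerivAt.const_mul
        ((k.factorial : ℝ) / ∏ i, ((β i).factorial : ℝ))
        (II_deriv hK hμ hV hU hxV (md_smooth hV β hF)
          (h := fun s => (∏ i, s i ^ β i) * h s) (by fun_prop) hε)))
    rw [hD.deriv, ← multi_sum k (fun γ =>
      II μ x (multiDeriv γ F) (fun s => (∏ i, s i ^ γ i) * h s) ε), pow_succ]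
    simp only [mul_neg, Finset.sum_neg_distrib, mul_one, neg_mul]
    congr 2
    refine Finset.sum_congr rfl fun β _ => ?_
    congr 1
    refine Finset.sum_congr rfl fun i _ => ?_
    unfold II
    refine integral_congr_ae ?_
    filter_upwards [ae_K hK hμ] with s hs
    rw [md_succ hV β i hF (hxV ε hε s hs)]
    congr 1
    rw [← mul_assoc]
    congr 1
    simp only [Pi.add_apply, pow_add, Finset.prod_mul_distrib]
    rw [mul_comm]
    congr 1
    rw [Finset.prod_eq_single i]
    · simp
    · intro j _ hj; simp [hj]
    · simp

lemma fundSol_smooth : ContDiffOn ℝ (⊤ : ℕ∞) (fundSol n) {0}ᶜ := by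
  have h1 : ContDiffOn ℝ (⊤ : ℕ∞) (fun y : EE n => ‖y‖) {0}ᶜ :=
    contDiffOn_id.norm ℝ (fun y hy => hy)
  have h0 : ∀ y ∈ ({0}ᶜ : Set (EE n)), ‖y‖ ≠ 0 := fun y hy => norm_ne_zero_iff.2 hy
  unfold fundSol
  by_cases hn : n = 2
  · simp only [hn, if_true]
    subst hn
    exact contDiffOn_const.mul (h1.log h0)
  · simp only [hn, if_false]
    exact contDiffOn_const.mul (h1.rpow_const_of_ne h0)

lemma inner_grad {V : Set (EE n)} (hV : IsOpen V) {F : EE n → ℝ}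
    (hF : ContDiffOn ℝ (⊤ : ℕ∞) F V) (v : EE n) {y : EE n} (hy : y ∈ V) :
    ⟪v, gradient F y⟫ = lineDeriv ℝ F y v := by
  refine Eq.trans ?_ (ld_eq hV hF v hy).symm
  rw [real_inner_comm, gradient, InnerProductSpace.toDual_symm_apply]

end aux

/-- For a fixed vector `v`, the map `ε ↦ ∫_{∂Ωⁱ} v · ∇G_n(x - ε•s) θ(s) dσ(s)` is smooth on
`{ε : |ε| · sup_{s∈∂Ωⁱ} ‖s‖ < ‖x‖}` and its `k`-th derivative at `ε = 0` is
`(-1)^k ∑_{|β|=k} (k!/β!) (v · (∇D^β G_n)(x)) ∫_{∂Ωⁱ} s^β θ(s) dσ(s)`. -/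
theorem stmt11 (n : ℕ) (hn : 2 ≤ n) (Ωi : Set (EuclideanSpace ℝ (Fin n)))
    (hΩ : IsOpen Ωi) (hb : Bornology.IsBounded Ωi)
    (hfin : IsFiniteMeasure (bdryMeasure n (frontier Ωi)))
    (θ : EuclideanSpace ℝ (Fin n) → ℝ) (hθ : Continuous θ)
    (v : EuclideanSpace ℝ (Fin n))
    (x : EuclideanSpace ℝ (Fin n)) (hx : x ≠ 0) (k : ℕ) :
    ContDiffOn ℝ (⊤ : ℕ∞)
        (fun ε : ℝ => ∫ s, ⟪v, gradient (fundSol n) (x - ε • s)⟫ * θ s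
          ∂(bdryMeasure n (frontier Ωi)))
        {ε : ℝ | |ε| * sSup ((fun s => ‖s‖) '' frontier Ωi) < ‖x‖} ∧
    iteratedDeriv k
        (fun ε : ℝ => ∫ s, ⟪v, gradient (fundSol n) (x - ε • s)⟫ * θ s
          ∂(bdryMeasure n (frontier Ωi))) 0 =
      (-1 : ℝ) ^ k * ∑ β ∈ Finset.Nat.antidiagonalTuple n k,
        ((k.factorial : ℝ) / ∏ i, ((β i).factorial : ℝ)) *
          ⟪v, gradient (multiDeriv β (fundSol n)) x⟫ *
          ∫ s, (∏ i, s i ^ β i) * θ s ∂(bdryMeasure n (frontier Ωi)) := by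
  set μ := bdryMeasure n (frontier Ωi) with hμdef
  have hK : IsCompact (frontier Ωi) :=
    Metric.isCompact_of_isClosed_isBounded isClosed_frontier
      (hb.closure.subset frontier_subset_closure)
  have hμ : μ.restrict (frontier Ωi) = μ := by
    rw [hμdef, bdryMeasure, Measure.restrict_restrict hK.measurableSet, Set.inter_self]
  have hV : IsOpen ({0}ᶜ : Set (EE n)) := isOpen_compl_singleton
  set R := sSup ((fun s => ‖s‖) '' frontier Ωi) with hR
  set U := {ε : ℝ | |ε| * R < ‖x‖} with hUdef
  have hU : IsOpen U := isOpen_lt (by fun_prop) continuous_const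
  have h0U : (0 : ℝ) ∈ U := by simp [hUdef, hx]
  have hxV : ∀ ε ∈ U, ∀ s ∈ frontier Ωi, x - ε • s ∈ ({0}ᶜ : Set (EE n)) := by
    intro ε hε s hs h0
    have hle : ‖s‖ ≤ R := le_csSup (hK.image continuous_norm).bddAbove ⟨s, hs, rfl⟩
    have h1 : x = ε • s := sub_eq_zero.1 h0
    have h2 : ‖x‖ = |ε| * ‖s‖ := by rw [h1, norm_smul, Real.norm_eq_abs]
    have h3 : |ε| * R < ‖x‖ := hε
    have := mul_le_mul_of_nonneg_left hle (abs_nonneg ε)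
    linarith
  have hG := fundSol_smooth (n := n)
  let F : EE n → ℝ := fun y => lineDeriv ℝ (fundSol n) y v
  have hF : ContDiffOn ℝ (⊤ : ℕ∞) F {0}ᶜ := ld_smooth hV hG v
  have hEq : Set.EqOn (fun ε : ℝ => ∫ s, ⟪v, gradient (fundSol n) (x - ε • s)⟫ * θ s ∂μ)
      (II μ x F θ) U := by
    intro ε hε
    refine integral_congr_ae ?_
    filter_upwards [ae_K hK hμ] with s hs
    rw [inner_grad hV hG v (hxV ε hε s hs)]
  constructor
  · refine ContDiffOn.congr ?_ hEq
    exact contDiffOn_infty.2 fun m => II_smooth hK hμ hV hU hxV m hF hθ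
  · rw [(hEq.eventuallyEq_of_mem (hU.mem_nhds h0U)).iteratedDeriv_eq k,
      II_iter hK hμ hV hU hxV hF hθ k 0 h0U]
    congr 1
    refine Finset.sum_congr rfl fun β _ => ?_
    rw [mul_assoc]
    congr 1
    rw [inner_grad hV (md_smooth hV β hG) v hx]
    simp only [II, zero_smul, sub_zero]
    rw [integral_const_mul, md_comm hV β hG v hx]
end

section
/- Let n ≥ 2, let Ω^o be a bounded open subset of ℝ^n with 0 ∈ Ω^o, let S = ∂Ω^o, and assume σ_S is a finite measure. Let θ : ℝ^n → ℝ be continuous, let v ∈ ℝ^n be a fixed vector (in the application v = ν_{Ω^i}(t), the outward unit normal of an inner domain at t), let t ∈ ℝ^n, and let k ∈ ℕ. Then the map ε ↦ −∫ v·∇G_n(ε·t − y)·θ(y) dσ_S(y) is smooth on {ε : |ε|·‖t‖ < dist(0, S)} and its k-th derivative at ε = 0 equals (−1)^k · Σ_{β ∈ ℕ^n, |β| = k} (k!/β!) · t^β · (v · ∫ (∇D^β G_n)(y)·θ(y) dσ_S(y)), where the last integral is the ℝ^n-valued Bochner integral and · denotes the Euclidean inner product. -/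
open MeasureTheory RealInnerProductSpace Pointwise

open scoped ContDiff Topology

namespace Stmt12Aux

/-- Functions smooth away from the origin and vanishing there. -/
def V (n : ℕ) : Submodule ℝ (EuclideanSpace ℝ (Fin n) → ℝ) where
  carrier := {F | F 0 = 0 ∧ ContDiffOn ℝ ∞ F {0}ᶜ}
  add_mem' := by
    rintro a b ⟨ha, ha'⟩ ⟨hb, hb'⟩
    exact ⟨by simp [ha, hb], ha'.add hb'⟩
  zero_mem' := ⟨rfl, contDiffOn_const⟩
  smul_mem' := by
    rintro c a ⟨ha, ha'⟩
    exact ⟨by simp [ha], ha'.const_smul c⟩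

variable {n : ℕ}


lemma isOpen_compl0 : IsOpen ({0}ᶜ : Set (EuclideanSpace ℝ (Fin n))) := isOpen_compl_singleton

lemma V.cda (F : V n) {x : EuclideanSpace ℝ (Fin n)} (hx : x ≠ 0) : ContDiffAt ℝ ∞ F.1 x :=
  F.2.2.contDiffAt (isOpen_compl0.mem_nhds hx)

lemma V.da (F : V n) {x : EuclideanSpace ℝ (Fin n)} (hx : x ≠ 0) : DifferentiableAt ℝ F.1 x :=
  (V.cda F hx).differentiableAt (by simp)

open Classical in
/-- underlying function of the directional derivative -/
noncomputable def dfun (w : EuclideanSpace ℝ (Fin n)) (F : EuclideanSpace ℝ (Fin n) → ℝ) : EuclideanSpace ℝ (Fin n) → ℝ := fun x => if x = 0 then 0 else fderiv ℝ F x w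

lemma dfun_of_ne (w : EuclideanSpace ℝ (Fin n)) (F : EuclideanSpace ℝ (Fin n) → ℝ) {x : EuclideanSpace ℝ (Fin n)} (hx : x ≠ 0) : dfun w F x = fderiv ℝ F x w := by
  simp [dfun, hx]

lemma dfun_mem (w : EuclideanSpace ℝ (Fin n)) (F : V n) : dfun w F.1 ∈ V n := by
  refine ⟨by simp [dfun], ?_⟩
  have h : ContDiffOn ℝ ∞ (fun x => fderiv ℝ F.1 x w) {0}ᶜ :=
    (F.2.2.fderiv_of_isOpen isOpen_compl0 (by simp)).clm_apply contDiffOn_const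
  exact h.congr fun x hx => dfun_of_ne w _ hx

/-- directional derivative as an endomorphism -/
noncomputable def D (w : EuclideanSpace ℝ (Fin n)) : Module.End ℝ (V n) where
  toFun F := ⟨dfun w F.1, dfun_mem w F⟩
  map_add' F G := by
    ext x
    by_cases hx : x = 0
    · simp [dfun, hx]
    · simp [dfun, hx, fderiv_add (V.da F hx) (V.da G hx)]
  map_smul' c F := by
    ext x
    by_cases hx : x = 0
    · simp [dfun, hx]
    · simp [dfun, hx, fderiv_const_smul (V.da F hx)]

lemma D_apply (w : EuclideanSpace ℝ (Fin n)) (F : V n) {x : EuclideanSpace ℝ (Fin n)} (hx : x ≠ 0) : (D w F).1 x = fderiv ℝ F.1 x w :=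
  dfun_of_ne w F.1 hx

lemma V.ext' {F G : V n} (h : ∀ x, x ≠ 0 → F.1 x = G.1 x) : F = G := by
  ext x
  by_cases hx : x = 0
  · rw [hx, F.2.1, G.2.1]
  · exact h x hx

lemma D_comm (w u : EuclideanSpace ℝ (Fin n)) : Commute (D (n := n) w) (D u) := by
  have key : ∀ (w u : EuclideanSpace ℝ (Fin n)) (F : V n) (x : EuclideanSpace ℝ (Fin n)), x ≠ 0 →
      (D w (D u F)).1 x = fderiv ℝ (fderiv ℝ F.1) x w u := by
    intro w u F x hx
    rw [D_apply _ _ hx]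
    have h1 : (D u F).1 =ᶠ[𝓝 x] fun y => fderiv ℝ F.1 y u := by
      filter_upwards [isOpen_compl0.mem_nhds hx] with y hy using D_apply _ _ hy
    rw [h1.fderiv_eq]
    have h2 : DifferentiableAt ℝ (fderiv ℝ F.1) x :=
      ((V.cda F hx).fderiv_right (m := ∞) (by simp)).differentiableAt (by simp)
    rw [fderiv_clm_apply h2 (differentiableAt_const u)]
    simp
  apply LinearMap.ext
  intro F
  apply V.ext'
  intro x hx
  change (D w (D u F)).1 x = (D u (D w F)).1 x
  rw [key _ _ _ _ hx, key _ _ _ _ hx]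
  exact (V.cda F hx).isSymmSndFDerivAt (by
    rw [minSmoothness_of_isRCLikeNormedField]; exact WithTop.coe_le_coe.2 le_top) w u

lemma D_sum (t : EuclideanSpace ℝ (Fin n)) : D t = ∑ i, t i • D (n := n) (EuclideanSpace.single i 1) := by
  apply LinearMap.ext
  intro F
  apply V.ext'
  intro x hx
  have h : t = ∑ i, t i • EuclideanSpace.single i (1:ℝ) := by
    ext j; simp [Finset.sum_apply, Pi.single_apply]
  rw [D_apply _ _ hx]
  simp only [LinearMap.sum_apply, LinearMap.smul_apply, AddSubmonoidClass.coe_finsetSum,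
    Submodule.coe_smul, Finset.sum_apply, Pi.smul_apply, D_apply _ _ hx]
  conv_lhs => rw [h]
  simp

lemma list_prod_smul {A : Type*} [Ring A] [Algebra ℝ A] {ι : Type*} (l : List ι) (c : ι → ℝ)
    (a : ι → A) : (l.map fun i => c i • a i).prod = (l.map c).prod • (l.map a).prod := by
  induction l with
  | nil => simp
  | cons i l ih => simp [ih, smul_smul, mul_comm]

/-- the multi-index derivative as an endomorphism -/
noncomputable def DM (β : Fin n → ℕ) : Module.End ℝ (V n) :=
  ((List.finRange n).map fun i => D (EuclideanSpace.single i 1) ^ β i).prod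

lemma D_pow (t : EuclideanSpace ℝ (Fin n)) (k : ℕ) : D t ^ k = ∑ β ∈ Finset.Nat.antidiagonalTuple n k,
    (((k.factorial : ℝ) / ∏ i, ((β i).factorial : ℝ)) * (∏ i, t i ^ β i)) • DM (n := n) β := by
  rw [D_sum t, Finset.sum_pow_eq_sum_piAntidiag_of_commute]
  · have hs : Finset.piAntidiag (Finset.univ : Finset (Fin n)) k
        = Finset.Nat.antidiagonalTuple n k := by
      ext β; simp [Finset.Nat.mem_antidiagonalTuple]
    rw [hs]
    refine Finset.sum_congr rfl fun β hβ => ?_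
    rw [Finset.Nat.mem_antidiagonalTuple] at hβ
    have hu : (Finset.univ : Finset (Fin n)) = (List.finRange n).toFinset := by ext; simp
    have h1 : ∀ (s : Finset (Fin n)) (hs : s = (List.finRange n).toFinset)
        (f : Fin n → Module.End ℝ (V n)) (hc),
        s.noncommProd f hc = ((List.finRange n).map f).prod := by
      rintro s rfl f hc
      exact Finset.noncommProd_toFinset _ _ _ (List.nodup_finRange n)
    rw [h1 _ hu]
    simp only [smul_pow]
    rw [list_prod_smul (List.finRange n) (fun i => t i ^ β i)
      (fun i => D (EuclideanSpace.single i 1) ^ β i)]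
    have hm := Nat.multinomial_spec Finset.univ β
    rw [hβ] at hm
    have hm' : (k.factorial : ℝ) / ∏ i, ((β i).factorial : ℝ)
        = (Nat.multinomial Finset.univ β : ℝ) := by
      rw [← hm]
      push_cast
      rw [mul_div_cancel_left₀]
      exact Finset.prod_ne_zero_iff.2 fun i _ => by positivity
    rw [hm', ← List.ofFn_eq_map, List.prod_ofFn, DM, mul_smul, ← nsmul_eq_mul,
      Nat.cast_smul_eq_nsmul]
  · intro i _ j _ _
    exact ((D_comm _ _).smul_left _).smul_right _

lemma pderiv_eq (i : Fin n) (F : V n) (f : EuclideanSpace ℝ (Fin n) → ℝ) (h : ∀ x, x ≠ 0 → f x = F.1 x) :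
    ∀ x, x ≠ 0 → pderiv' i f x = (D (EuclideanSpace.single i 1) F).1 x := by
  intro x hx
  have h1 : f =ᶠ[𝓝 x] F.1 := by
    filter_upwards [isOpen_compl0.mem_nhds hx] with y hy using h y hy
  rw [D_apply _ _ hx, pderiv', h1.lineDeriv_eq, (V.da F hx).lineDeriv_eq_fderiv]

lemma pderiv_iter_eq (i : Fin n) (m : ℕ) (F : V n) (f : EuclideanSpace ℝ (Fin n) → ℝ) (h : ∀ x, x ≠ 0 → f x = F.1 x) :
    ∀ x, x ≠ 0 → (pderiv' i)^[m] f x = ((D (EuclideanSpace.single i 1) ^ m) F).1 x := by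
  induction m with
  | zero => simpa using h
  | succ m ih =>
    rw [Function.iterate_succ_apply', pow_succ']
    exact pderiv_eq i _ _ ih

lemma multiDeriv_eq (β : Fin n → ℕ) (F : V n) (f : EuclideanSpace ℝ (Fin n) → ℝ) (h : ∀ x, x ≠ 0 → f x = F.1 x) :
    ∀ x, x ≠ 0 → multiDeriv β f x = (DM β F).1 x := by
  unfold multiDeriv DM
  generalize List.finRange n = l
  induction l with
  | nil => simpa using h
  | cons i l ih =>
    rw [List.foldr_cons, List.map_cons, List.prod_cons]
    exact pderiv_iter_eq i _ _ _ ih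

lemma D_parity (w : EuclideanSpace ℝ (Fin n)) (F : V n) (s : ℝ) (h : ∀ x, F.1 (-x) = s * F.1 x) (x : EuclideanSpace ℝ (Fin n)) :
    (D w F).1 (-x) = (-s) * (D w F).1 x := by
  by_cases hx : x = 0
  · subst hx; simp [(D w F).2.1]
  have hx' : -x ≠ 0 := neg_ne_zero.2 hx
  rw [D_apply _ _ hx, D_apply _ _ hx']
  have h1 : HasFDerivAt (fun y => F.1 (-y)) ((fderiv ℝ F.1 (-x)).comp (-ContinuousLinearMap.id ℝ (EuclideanSpace ℝ (Fin n)))) x :=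
    HasFDerivAt.comp x (V.da F hx').hasFDerivAt (hasFDerivAt_id x).neg
  have h2 : HasFDerivAt (fun y => F.1 (-y)) (s • fderiv ℝ F.1 x) x := by
    simp only [h]
    exact (V.da F hx).hasFDerivAt.const_mul s
  have := congrArg (fun L => L w) (h1.unique h2)
  simp at this
  linarith

lemma D_pow_parity (w : EuclideanSpace ℝ (Fin n)) (F : V n) (s : ℝ) (h : ∀ x, F.1 (-x) = s * F.1 x) (k : ℕ) (x : EuclideanSpace ℝ (Fin n)) :
    ((D w ^ k) F).1 (-x) = ((-1)^k * s) * ((D w ^ k) F).1 x := by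
  induction k generalizing x with
  | zero => simpa using h x
  | succ k ih =>
    rw [pow_succ']
    have := D_parity w _ _ ih x
    change (D w ((D w ^ k) F)).1 (-x) = _ * (D w ((D w ^ k) F)).1 x
    rw [this]; ring

/-- the fundamental solution as an element of `V` -/
noncomputable def GV (n : ℕ) (_hn : 2 ≤ n) : V n := ⟨fundSol n, by
  constructor
  · unfold fundSol
    split_ifs with h
    · simp
    · have : (2:ℝ) - n ≠ 0 := by
        intro h'
        apply h
        have : (n:ℝ) = 2 := by linarith
        exact_mod_cast this
      simp [Real.zero_rpow this]
  · intro x hx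
    apply ContDiffAt.contDiffWithinAt
    have hN : ContDiffAt ℝ ∞ (fun x : EuclideanSpace ℝ (Fin n) => ‖x‖) x := contDiffAt_norm ℝ hx
    have hne : ‖x‖ ≠ 0 := norm_ne_zero_iff.2 hx
    unfold fundSol
    split_ifs with h
    · exact contDiffAt_const.mul (hN.log hne)
    · exact contDiffAt_const.mul (hN.rpow_const_of_ne hne)⟩

lemma GV_even (hn : 2 ≤ n) (x : EuclideanSpace ℝ (Fin n)) : (GV n hn).1 (-x) = 1 * (GV n hn).1 x := by
  simp [GV, fundSol]

section integral

/-- the parametric integral -/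
noncomputable def I (μ : Measure (EuclideanSpace ℝ (Fin n))) (θ : EuclideanSpace ℝ (Fin n) → ℝ) (t : EuclideanSpace ℝ (Fin n)) (F : V n) (ε : ℝ) : ℝ := ∫ y, F.1 (ε • t - y) * θ y ∂μ

/-- admissible parameters -/
def U (S : Set (EuclideanSpace ℝ (Fin n))) (t : EuclideanSpace ℝ (Fin n)) : Set ℝ := {ε | ε • t ∉ S}

lemma isOpen_U (S : Set (EuclideanSpace ℝ (Fin n))) (hS : IsCompact S) (t : EuclideanSpace ℝ (Fin n)) : IsOpen (U S t) :=
  hS.isClosed.isOpen_compl.preimage (f := fun ε : ℝ => ε • t) (by fun_prop)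

lemma integrable_of (μ : Measure (EuclideanSpace ℝ (Fin n))) [IsFiniteMeasure μ] (S : Set (EuclideanSpace ℝ (Fin n)))
    (hS : IsCompact S) (hμ : μ.restrict S = μ) {X : Type*} [NormedAddCommGroup X] (f : EuclideanSpace ℝ (Fin n) → X)
    (hf : ContinuousOn f S) : Integrable f μ := by
  have := hf.integrableOn_compact (μ := μ) hS
  rwa [IntegrableOn, hμ] at this

lemma cont_prod (S : Set (EuclideanSpace ℝ (Fin n))) (θ : EuclideanSpace ℝ (Fin n) → ℝ) (hθ : Continuous θ)
    (t : EuclideanSpace ℝ (Fin n)) (F : V n) : ContinuousOn (fun p : ℝ × EuclideanSpace ℝ (Fin n) => F.1 (p.1 • t - p.2) * θ p.2)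
    (U S t ×ˢ S) := by
  apply ContinuousOn.mul
  · refine F.2.2.continuousOn.comp (by fun_prop) ?_
    rintro ⟨ε, y⟩ ⟨h1, h2⟩
    simp only [Set.mem_compl_iff, Set.mem_singleton_iff]
    intro h
    apply h1
    change ε • t ∈ S
    rw [sub_eq_zero.1 h]; exact h2
  · fun_prop

lemma cont_sec (S : Set (EuclideanSpace ℝ (Fin n))) (θ : EuclideanSpace ℝ (Fin n) → ℝ) (hθ : Continuous θ)
    (t : EuclideanSpace ℝ (Fin n)) (F : V n) {ε : ℝ} (hε : ε ∈ U S t) :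
    ContinuousOn (fun y => F.1 (ε • t - y) * θ y) S :=
  (cont_prod S θ hθ t F).comp (f := fun y => (ε, y)) (by fun_prop) fun y hy => ⟨hε, hy⟩

lemma hasDerivAt_I (μ : Measure (EuclideanSpace ℝ (Fin n))) [IsFiniteMeasure μ] (S : Set (EuclideanSpace ℝ (Fin n)))
    (hS : IsCompact S) (hμ : μ.restrict S = μ) (θ : EuclideanSpace ℝ (Fin n) → ℝ) (hθ : Continuous θ)
    (t : EuclideanSpace ℝ (Fin n)) (F : V n) {ε : ℝ} (hε : ε ∈ U S t) :
    HasDerivAt (I μ θ t F) (I μ θ t (D t F) ε) ε := by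
  have hU := (isOpen_U S hS t)
  obtain ⟨δ, hδ, hsub⟩ := Metric.nhds_basis_closedBall.mem_iff.1 (hU.mem_nhds hε)
  have hK : IsCompact (Metric.closedBall ε δ ×ˢ S) := (isCompact_closedBall ε δ).prod hS
  obtain ⟨C, hC⟩ := hK.exists_bound_of_continuousOn
    ((cont_prod S θ hθ t (D t F)).mono (Set.prod_mono hsub subset_rfl))
  have hae : ∀ᵐ y ∂μ, y ∈ S := by
    rw [← hμ]; exact ae_restrict_mem hS.measurableSet
  refine (hasDerivAt_integral_of_dominated_loc_of_deriv_le (μ := μ)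
    (F := fun ε y => F.1 (ε • t - y) * θ y)
    (F' := fun ε y => (D t F).1 (ε • t - y) * θ y) (bound := fun _ => C)
    (Metric.closedBall_mem_nhds ε hδ) ?_ ?_ ?_ ?_ ?_ ?_).2
  · filter_upwards [hU.mem_nhds hε] with x hx
    exact (integrable_of μ S hS hμ _ (cont_sec S θ hθ t F hx)).aestronglyMeasurable
  · exact integrable_of μ S hS hμ _ (cont_sec S θ hθ t F hε)
  · exact (integrable_of μ S hS hμ _ (cont_sec S θ hθ t (D t F) hε)).aestronglyMeasurable
  · filter_upwards [hae] with y hy x hx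
    exact hC (x, y) ⟨hx, hy⟩
  · exact integrable_const C
  · filter_upwards [hae] with y hy x hx
    have hne : x • t - y ≠ 0 := by
      intro h
      apply hsub hx
      change x • t ∈ S
      rw [sub_eq_zero.1 h]; exact hy
    apply HasDerivAt.mul_const
    rw [D_apply _ _ hne]
    have h2 : HasDerivAt (fun x : ℝ => x • t - y) t x := by
      simpa using ((hasDerivAt_id x).smul_const t).sub_const y
    exact (V.da F hne).hasFDerivAt.comp_hasDerivAt x h2

lemma contDiffOn_I (μ : Measure (EuclideanSpace ℝ (Fin n))) [IsFiniteMeasure μ] (S : Set (EuclideanSpace ℝ (Fin n)))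
    (hS : IsCompact S) (hμ : μ.restrict S = μ) (θ : EuclideanSpace ℝ (Fin n) → ℝ) (hθ : Continuous θ)
    (t : EuclideanSpace ℝ (Fin n)) (F : V n) : ContDiffOn ℝ ∞ (I μ θ t F) (U S t) := by
  have hU := (isOpen_U S hS t)
  refine contDiffOn_infty.2 fun m => ?_
  induction m generalizing F with
  | zero =>
    refine contDiffOn_zero.2 fun x hx => ?_
    exact (hasDerivAt_I μ S hS hμ θ hθ t F hx).continuousAt.continuousWithinAt
  | succ m ih =>
    push_cast
    refine (contDiffOn_succ_iff_deriv_of_isOpen hU).2 ⟨fun x hx =>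
      (hasDerivAt_I μ S hS hμ θ hθ t F hx).differentiableAt.differentiableWithinAt, by simp, ?_⟩
    exact (ih (D t F)).congr fun x hx => (hasDerivAt_I μ S hS hμ θ hθ t F hx).deriv

lemma iteratedDeriv_I (μ : Measure (EuclideanSpace ℝ (Fin n))) [IsFiniteMeasure μ] (S : Set (EuclideanSpace ℝ (Fin n)))
    (hS : IsCompact S) (hμ : μ.restrict S = μ) (θ : EuclideanSpace ℝ (Fin n) → ℝ) (hθ : Continuous θ)
    (t : EuclideanSpace ℝ (Fin n)) (F : V n) (k : ℕ) {ε : ℝ} (hε : ε ∈ U S t) :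
    iteratedDeriv k (I μ θ t F) ε = I μ θ t ((D t ^ k) F) ε := by
  have hU := (isOpen_U S hS t)
  induction k generalizing ε with
  | zero => simp
  | succ k ih =>
    rw [iteratedDeriv_succ]
    have : iteratedDeriv k (I μ θ t F) =ᶠ[𝓝 ε] I μ θ t ((D t ^ k) F) := by
      filter_upwards [hU.mem_nhds hε] with x hx using ih hx
    rw [this.deriv_eq, (hasDerivAt_I μ S hS hμ θ hθ t _ hε).deriv, pow_succ']
    rfl

end integral

end Stmt12Aux

/-- For a fixed vector `v`, the map `ε ↦ -∫_{∂Ωᵒ} v · ∇G_n(ε•t - y) θ(y) dσ(y)` is smooth on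
`{ε : |ε| · ‖t‖ < dist(0, ∂Ωᵒ)}` and its `k`-th derivative at `ε = 0` is
`(-1)^k ∑_{|β|=k} (k!/β!) t^β (v · ∫_{∂Ωᵒ} (∇D^β G_n)(y) θ(y) dσ(y))`. -/
theorem stmt12 (n : ℕ) (hn : 2 ≤ n) (Ωo : Set (EuclideanSpace ℝ (Fin n)))
    (hΩ : IsOpen Ωo) (hb : Bornology.IsBounded Ωo) (h0 : (0 : EuclideanSpace ℝ (Fin n)) ∈ Ωo)
    (hfin : IsFiniteMeasure (bdryMeasure n (frontier Ωo)))
    (θ : EuclideanSpace ℝ (Fin n) → ℝ) (hθ : Continuous θ)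
    (v : EuclideanSpace ℝ (Fin n))
    (t : EuclideanSpace ℝ (Fin n)) (k : ℕ) :
    ContDiffOn ℝ (⊤ : ℕ∞)
        (fun ε : ℝ => -∫ y, ⟪v, gradient (fundSol n) (ε • t - y)⟫ * θ y
          ∂(bdryMeasure n (frontier Ωo)))
        {ε : ℝ | |ε| * ‖t‖ < Metric.infDist (0 : EuclideanSpace ℝ (Fin n)) (frontier Ωo)} ∧
    iteratedDeriv k
        (fun ε : ℝ => -∫ y, ⟪v, gradient (fundSol n) (ε • t - y)⟫ * θ y
          ∂(bdryMeasure n (frontier Ωo))) 0 =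
      (-1 : ℝ) ^ k * ∑ β ∈ Finset.Nat.antidiagonalTuple n k,
        ((k.factorial : ℝ) / ∏ i, ((β i).factorial : ℝ)) * (∏ i, t i ^ β i) *
          ⟪v, ∫ y, θ y • gradient (multiDeriv β (fundSol n)) y
            ∂(bdryMeasure n (frontier Ωo))⟫ := by
  have _ := hfin
  have hScl : IsClosed (frontier Ωo) := isClosed_frontier
  have hS : IsCompact (frontier Ωo) :=
    Metric.isCompact_of_isClosed_isBounded hScl (hb.closure.subset frontier_subset_closure)
  have hμ : (bdryMeasure n (frontier Ωo)).restrict (frontier Ωo) = bdryMeasure n (frontier Ωo) := by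
    unfold bdryMeasure
    rw [Measure.restrict_restrict hScl.measurableSet, Set.inter_self]
  have h0S : (0 : EuclideanSpace ℝ (Fin n)) ∉ frontier Ωo := by
    rw [hΩ.frontier_eq]; exact fun h => h.2 h0
  have hae : ∀ᵐ y ∂(bdryMeasure n (frontier Ωo)), y ∈ frontier Ωo := by
    rw [← hμ]; exact ae_restrict_mem hScl.measurableSet
  generalize bdryMeasure n (frontier Ωo) = μ at *
  generalize frontier Ωo = S at *
  have hne : ∀ y ∈ S, y ≠ 0 := fun y hy h => h0S (h ▸ hy)
  have hgr : ∀ (f : EuclideanSpace ℝ (Fin n) → ℝ) (F : Stmt12Aux.V n),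
      (∀ x, x ≠ 0 → f x = F.1 x) → ∀ x, x ≠ 0 →
      ⟪v, gradient f x⟫ = (Stmt12Aux.D v F).1 x := by
    intro f F h x hx
    have h1 : f =ᶠ[𝓝 x] F.1 := by
      filter_upwards [Stmt12Aux.isOpen_compl0.mem_nhds hx] with y hy using h y hy
    rw [Stmt12Aux.D_apply _ _ hx, h1.gradient_eq, inner_gradient_right]
    simp
  set G := Stmt12Aux.GV n hn with hG
  have hGf : ∀ x, x ≠ 0 → fundSol n x = G.1 x := fun x _ => rfl
  have h0U : (0:ℝ) ∈ Stmt12Aux.U S t := by simpa [Stmt12Aux.U] using h0S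
  have hUo := Stmt12Aux.isOpen_U S hS t
  have hEq : ∀ ε ∈ Stmt12Aux.U S t,
      (-∫ y, ⟪v, gradient (fundSol n) (ε • t - y)⟫ * θ y ∂μ)
        = -Stmt12Aux.I μ θ t (Stmt12Aux.D v G) ε := by
    intro ε hε
    congr 1
    apply integral_congr_ae
    filter_upwards [hae] with y hy
    have : ε • t - y ≠ 0 := by
      intro h
      apply hε
      change ε • t ∈ S
      rw [sub_eq_zero.1 h]; exact hy
    simp only [hgr _ _ hGf _ this]
  constructor
  · refine ((Stmt12Aux.contDiffOn_I μ S hS hμ θ hθ t (Stmt12Aux.D v G)).neg.congr hEq).mono ?_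
    intro ε hε hmem
    have h1 := Metric.infDist_le_dist_of_mem (x := (0 : EuclideanSpace ℝ (Fin n))) hmem
    rw [dist_zero_left, norm_smul, Real.norm_eq_abs] at h1
    exact absurd hε (not_lt.2 h1)
  · have hEq' : (fun ε : ℝ => -∫ y, ⟪v, gradient (fundSol n) (ε • t - y)⟫ * θ y ∂μ)
        =ᶠ[𝓝 0] fun ε => -Stmt12Aux.I μ θ t (Stmt12Aux.D v G) ε := by
      filter_upwards [hUo.mem_nhds h0U] with ε hε using hEq ε hε
    rw [hEq'.iteratedDeriv_eq, iteratedDeriv_fun_neg,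
      Stmt12Aux.iteratedDeriv_I μ S hS hμ θ hθ t _ k h0U]
    have hpar := Stmt12Aux.D_pow_parity t _ _
      (Stmt12Aux.D_parity v G _ (Stmt12Aux.GV_even hn)) k
    have hcg : ∀ β : Fin n → ℕ, ∀ y ∈ S, gradient (multiDeriv β (fundSol n)) y
        = gradient (Stmt12Aux.DM β G).1 y := by
      intro β y hy
      apply Filter.EventuallyEq.gradient_eq
      filter_upwards [Stmt12Aux.isOpen_compl0.mem_nhds (hne y hy)] with x hx
      exact Stmt12Aux.multiDeriv_eq β G _ hGf x hx
    have hint : ∀ β : Fin n → ℕ, Integrable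
        (fun y => θ y • gradient (multiDeriv β (fundSol n)) y) μ := by
      intro β
      apply Stmt12Aux.integrable_of μ S hS hμ
      refine ContinuousOn.smul hθ.continuousOn ?_
      refine ContinuousOn.congr ?_ (hcg β)
      refine (InnerProductSpace.toDual ℝ _).symm.continuous.comp_continuousOn ?_
      exact ((Stmt12Aux.DM β G).2.2.continuousOn_fderiv_of_isOpen Stmt12Aux.isOpen_compl0
        (by simp)).mono fun y hy => hne y hy
    have hinn : ∀ β : Fin n → ℕ, ⟪v, ∫ y, θ y • gradient (multiDeriv β (fundSol n)) y ∂μ⟫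
        = ∫ y, (Stmt12Aux.D v (Stmt12Aux.DM β G)).1 y * θ y ∂μ := by
      intro β
      rw [← integral_inner (hint β)]
      apply integral_congr_ae
      filter_upwards [hae] with y hy
      rw [inner_smul_right,
        hgr _ _ (Stmt12Aux.multiDeriv_eq β G _ hGf) y (hne y hy), mul_comm]
    have hint2 : ∀ F : Stmt12Aux.V n, Integrable (fun y => F.1 y * θ y) μ := by
      intro F
      apply Stmt12Aux.integrable_of μ S hS hμ
      exact (F.2.2.continuousOn.mono fun y hy => hne y hy).mul hθ.continuousOn
    have hcomm : (Stmt12Aux.D t ^ k) (Stmt12Aux.D v G)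
        = Stmt12Aux.D v ((Stmt12Aux.D t ^ k) G) :=
      congrArg (fun L : Module.End ℝ (Stmt12Aux.V n) => L G)
        ((Stmt12Aux.D_comm t v).pow_left k).eq
    have hexp : ∀ y, ((Stmt12Aux.D t ^ k) (Stmt12Aux.D v G)).1 y
        = ∑ β ∈ Finset.Nat.antidiagonalTuple n k,
          (((k.factorial : ℝ) / ∏ i, ((β i).factorial : ℝ)) * (∏ i, t i ^ β i)) *
            (Stmt12Aux.D v (Stmt12Aux.DM β G)).1 y := by
      intro y
      rw [hcomm, Stmt12Aux.D_pow]
      simp only [LinearMap.sum_apply, LinearMap.smul_apply, map_sum, map_smul,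
        AddSubmonoidClass.coe_finsetSum, Submodule.coe_smul, Finset.sum_apply, Pi.smul_apply,
        smul_eq_mul]
    simp only [hinn]
    unfold Stmt12Aux.I
    simp only [zero_smul, zero_sub, hpar]
    simp only [mul_assoc, integral_const_mul]
    simp only [hexp, Finset.sum_mul]
    rw [integral_finsetSum]
    · simp only [mul_assoc, integral_const_mul]
      ring
    · intro β _
      simp only [mul_assoc]
      exact (((hint2 (Stmt12Aux.D v (Stmt12Aux.DM β G))).const_mul _).const_mul _)
end
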